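/- arXiv:1406.6789 — 14 statements merged into one kernel-verified Lean document; each statement's English description precedes it below -/
import Mathlib

section
/- Let A be a semiabelian category and let α : X → Y and β : Y → Z be morphisms in A. Then the canonical image monomorphism im α : Im α → Y is a kernel of β if and only if the canonical cokernel projection cok α : Y → Cok α is a cokernel of ker β : Ker β → Y (i.e., im α = ker β holds if and only if cok α = coim β holds). -/
open CategoryTheory CategoryTheory.Limits

universe v u

variable {C : Type u} [Category.{v} C] [Preadditive C] [HasFiniteBiproducts C]
  [HasKernels C] [HasCokernels C]

/-- `ι` is a kernel of `g`, i.e. `ι ≫ g = 0` and `ι` is a limit kernel fork of `g`. -/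
def IsKernelOf {X Y Z : C} (ι : X ⟶ Y) (g : Y ⟶ Z) : Prop :=
  ∃ w : ι ≫ g = 0, Nonempty (IsLimit (KernelFork.ofι ι w))

/-- `π` is a cokernel of `g`, i.e. `g ≫ π = 0` and `π` is a colimit cokernel cofork of `g`. -/
def IsCokernelOf {X Y Q : C} (g : X ⟶ Y) (π : Y ⟶ Q) : Prop :=
  ∃ w : g ≫ π = 0, Nonempty (IsColimit (CokernelCofork.ofπ π w))

/-- A morphism is *a kernel* if it is a kernel of some morphism (a normal monomorphism). -/
def IsAKernel {X Y : C} (ι : X ⟶ Y) : Prop :=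
  ∃ (Z : C) (g : Y ⟶ Z), IsKernelOf ι g

/-- A morphism is *a cokernel* if it is a cokernel of some morphism (a normal epimorphism). -/
def IsACokernel {Y Q : C} (π : Y ⟶ Q) : Prop :=
  ∃ (X : C) (g : X ⟶ Y), IsCokernelOf g π

/-- A kernel `ι` is semistable if every pushout of `ι` along an arbitrary morphism
is again a kernel. -/
def SemistableKernel {X Y : C} (ι : X ⟶ Y) : Prop :=
  IsAKernel ι ∧ ∀ {Z P : C} (s : X ⟶ Z) (t : Y ⟶ P) (y : Z ⟶ P),
    IsPushout ι s t y → IsAKernel y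

/-- A cokernel `π` is semistable if every pullback of `π` along an arbitrary morphism
is again a cokernel. -/
def SemistableCokernel {Y Q : C} (π : Y ⟶ Q) : Prop :=
  IsACokernel π ∧ ∀ {P Z : C} (t : P ⟶ Y) (y : P ⟶ Z) (s : Z ⟶ Q),
    IsPullback t y π s → IsACokernel y

/-- In a semiabelian category, for morphisms `α : X ⟶ Y` and `β : Y ⟶ Z`,
the canonical image monomorphism of `α` is a kernel of `β` if and only if the canonical
cokernel projection of `α` is a cokernel of `ker β`. -/
theorem im_eq_ker_iff_cok_eq_coim
    (hsemi : ∀ {X Y : C} (f : X ⟶ Y),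
      Mono (Abelian.coimageImageComparison f) ∧ Epi (Abelian.coimageImageComparison f))
    {X Y Z : C} (α : X ⟶ Y) (β : Y ⟶ Z) :
    IsKernelOf (Abelian.image.ι α) β ↔ IsCokernelOf (kernel.ι β) (cokernel.π α) := by
  have hα : kernel.lift (cokernel.π α) α (cokernel.condition α) ≫ Abelian.image.ι α = α :=
    kernel.lift_ι _ _ _
  have hι : Abelian.image.ι α ≫ cokernel.π α = 0 := kernel.condition _
  constructor
  · rintro ⟨w, ⟨h⟩⟩
    obtain ⟨l, hl⟩ := KernelFork.IsLimit.lift' h (kernel.ι β) (kernel.condition β)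
    replace hl : l ≫ Abelian.image.ι α = kernel.ι β := hl
    refine ⟨by rw [← hl, Category.assoc, hι, comp_zero], ⟨?_⟩⟩
    refine CokernelCofork.IsColimit.ofπ _ _
      (fun k hk => cokernel.desc α k ?_) (fun k hk => cokernel.π_desc _ _ _) ?_
    · rw [← hα, ← kernel.lift_ι β _ w]
      simp only [Category.assoc, hk, comp_zero]
    · intro T k hk m hm
      rw [← cancel_epi (cokernel.π α), hm, cokernel.π_desc]
  · rintro ⟨w, ⟨h⟩⟩
    obtain ⟨l, hl⟩ := CokernelCofork.IsColimit.desc' h β (kernel.condition β)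
    replace hl : cokernel.π α ≫ l = β := hl
    refine ⟨by rw [← hl, ← Category.assoc, hι, zero_comp], ⟨?_⟩⟩
    refine KernelFork.IsLimit.ofι _ _
      (fun k hk => kernel.lift (cokernel.π α) k ?_) (fun k hk => kernel.lift_ι _ _ _) ?_
    · rw [← kernel.lift_ι β k hk, Category.assoc, w, comp_zero]
    · intro T k hk m hm
      rw [← cancel_mono (Abelian.image.ι α), hm]
      exact (kernel.lift_ι _ _ _).symm
end

section
/- Let A be a left semiabelian category, and let β : A → B, α : B → C and ρ : C → D be morphisms such that α is a cokernel of β and the canonical image monomorphism im β : Im β → B is a kernel of ρ∘α. Then ρ is a monomorphism. -/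
open CategoryTheory CategoryTheory.Limits

universe v u

variable {C : Type u} [Category.{v} C] [Preadditive C] [HasFiniteBiproducts C]
  [HasKernels C] [HasCokernels C]

/-- In a left semiabelian category, if `α` is a cokernel of `β` and the
canonical image monomorphism `im β` is a kernel of `ρ ∘ α`, then `ρ` is a monomorphism. -/
theorem mono_of_image_isKernelOf
    (hsemi : ∀ {X Y : C} (f : X ⟶ Y), Mono (Abelian.coimageImageComparison f))
    {A B D E : C} (β : A ⟶ B) (α : B ⟶ D) (ρ : D ⟶ E)
    (hα : IsCokernelOf β α)
    (him : IsKernelOf (Abelian.image.ι β) (α ≫ ρ)) :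
    Mono ρ := by
  obtain ⟨w, ⟨hc⟩⟩ := hα
  obtain ⟨w', ⟨hk⟩⟩ := him
  have hepi : Epi α := by
    constructor
    intro Z a b hab
    exact Cofork.IsColimit.hom_ext hc hab
  have hβ : β ≫ Abelian.coimage.π (α ≫ ρ) = 0 := by
    have h : β ≫ α ≫ ρ = 0 := by rw [← Category.assoc, w, zero_comp]
    have h2 : β = kernel.lift (α ≫ ρ) β h ≫ kernel.ι (α ≫ ρ) := (kernel.lift_ι _ _ _).symm
    rw [h2, Category.assoc]
    have h3 : kernel.ι (α ≫ ρ) ≫ Abelian.coimage.π (α ≫ ρ) = 0 := cokernel.condition _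
    rw [h3, comp_zero]
  obtain ⟨g, hg⟩ : ∃ g : D ⟶ Abelian.coimage (α ≫ ρ), α ≫ g = Abelian.coimage.π (α ≫ ρ) :=
    ⟨_, (CokernelCofork.IsColimit.desc' hc _ hβ).2⟩
  have himα : Abelian.image.ι β ≫ α = 0 := by
    have h : α = cokernel.π β ≫ cokernel.desc β α w := (cokernel.π_desc _ _ _).symm
    have h3 : Abelian.image.ι β ≫ cokernel.π β = 0 := kernel.condition _
    rw [h, ← Category.assoc, h3, zero_comp]
  have hkα : kernel.ι (α ≫ ρ) ≫ α = 0 := by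
    obtain ⟨l, hl⟩ := KernelFork.IsLimit.lift' hk (kernel.ι (α ≫ ρ)) (kernel.condition _)
    have hl' : l ≫ Abelian.image.ι β = kernel.ι (α ≫ ρ) := hl
    rw [← hl', Category.assoc, himα, comp_zero]
  obtain ⟨k, hk'⟩ : ∃ k : Abelian.coimage (α ≫ ρ) ⟶ D, Abelian.coimage.π (α ≫ ρ) ≫ k = α :=
    ⟨cokernel.desc _ α hkα, cokernel.π_desc _ _ _⟩
  have hgk : g ≫ k = 𝟙 D := by
    rw [← cancel_epi α, ← Category.assoc, hg, hk', Category.comp_id]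
  have hg_mono : Mono g := by
    have : Mono (g ≫ k) := by rw [hgk]; infer_instance
    exact mono_of_mono g k
  have hcmp := hsemi (α ≫ ρ)
  have hρ : ρ = g ≫ Abelian.coimageImageComparison (α ≫ ρ) ≫ Abelian.image.ι (α ≫ ρ) := by
    rw [← cancel_epi α, ← Category.assoc α g, hg]
    exact (Abelian.coimage_image_factorisation (α ≫ ρ)).symm
  rw [hρ]
  infer_instance
end

section
/- Let A be a right semiabelian category, and let β : A → B′, ρ : B′ → B and α : B → C be morphisms such that ρ is a kernel (i.e., a kernel of some morphism) and the canonical coimage projection coim α : B → Coim α is a cokernel of ρ∘β. Then the canonical image monomorphism im β : Im β → B′ is a kernel of α∘ρ. -/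
open CategoryTheory CategoryTheory.Limits

universe v u

variable {C : Type u} [Category.{v} C] [Preadditive C] [HasFiniteBiproducts C]
  [HasKernels C] [HasCokernels C]

/-- In a right semiabelian category, if `ρ` is a kernel (of some morphism)
and the canonical coimage projection `coim α` is a cokernel of `ρ ∘ β`, then the canonical
image monomorphism `im β` is a kernel of `α ∘ ρ`. -/
theorem image_isKernelOf_of_coimage_isCokernelOf
    (hsemi : ∀ {X Y : C} (f : X ⟶ Y), Epi (Abelian.coimageImageComparison f))
    {A B' B D : C} (β : A ⟶ B') (ρ : B' ⟶ B) (α : B ⟶ D)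
    (hρ : IsAKernel ρ)
    (hcoim : IsCokernelOf (β ≫ ρ) (Abelian.coimage.π α)) :
    IsKernelOf (Abelian.image.ι β) (ρ ≫ α) := by
  obtain ⟨Z, g, wρ, ⟨hlρ⟩⟩ := hρ
  obtain ⟨wc, ⟨hc⟩⟩ := hcoim
  have hmono : Mono ρ := mono_of_isLimit_fork hlρ
  have hα : (β ≫ ρ) ≫ α = 0 := by
    rw [← Abelian.coimage.fac α, ← Category.assoc, wc, zero_comp]
  have w : Abelian.image.ι β ≫ ρ ≫ α = 0 := by
    have h1 : cokernel.π β ≫ cokernel.desc β (ρ ≫ α) (by simpa using hα) = ρ ≫ α :=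
      cokernel.π_desc _ _ _
    rw [← h1, ← Category.assoc, kernel.condition, zero_comp]
  -- the image of `β ≫ ρ` factors through `ρ`
  have hg : Abelian.image.ι (β ≫ ρ) ≫ g = 0 := by
    have h1 : cokernel.π (β ≫ ρ) ≫ cokernel.desc (β ≫ ρ) g (by simp [wρ]) = g :=
      cokernel.π_desc _ _ _
    rw [← h1, ← Category.assoc, kernel.condition, zero_comp]
  obtain ⟨j, hj⟩ : ∃ j : Abelian.image (β ≫ ρ) ⟶ B', j ≫ ρ = Abelian.image.ι (β ≫ ρ) :=
    ⟨_, (KernelFork.IsLimit.lift' hlρ _ hg).2⟩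
  have hepi : Epi (Abelian.factorThruImage (β ≫ ρ)) := by
    have h1 : Abelian.factorThruImage (β ≫ ρ) =
        Abelian.coimage.π (β ≫ ρ) ≫ Abelian.coimageImageComparison (β ≫ ρ) := by
      rw [← cancel_mono (Abelian.image.ι (β ≫ ρ)), Category.assoc,
        Abelian.coimage_image_factorisation, Abelian.image.fac]
    have := hsemi (β ≫ ρ)
    rw [h1]
    exact epi_comp _ _
  have hβ : Abelian.factorThruImage (β ≫ ρ) ≫ j = β := by
    rw [← cancel_mono ρ, Category.assoc, hj, Abelian.image.fac]
  have hjc : j ≫ cokernel.π β = 0 := by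
    rw [← cancel_epi (Abelian.factorThruImage (β ≫ ρ)), ← Category.assoc, hβ,
      cokernel.condition, comp_zero]
  have key : ∀ {T : C} (t : T ⟶ B'), t ≫ ρ ≫ α = 0 → t ≫ cokernel.π β = 0 := by
    intro T t ht
    have h1 : (t ≫ ρ) ≫ Abelian.coimage.π α = 0 := by
      rw [← kernel.lift_ι α (t ≫ ρ) (by simpa using ht), Category.assoc,
        cokernel.condition, comp_zero]
    obtain ⟨d, hd⟩ : ∃ d, Abelian.coimage.π α ≫ d = cokernel.π (β ≫ ρ) :=
      ⟨_, (CokernelCofork.IsColimit.desc' hc _ (cokernel.condition (β ≫ ρ))).2⟩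
    have h2 : (t ≫ ρ) ≫ cokernel.π (β ≫ ρ) = 0 := by
      rw [← hd, ← Category.assoc, h1, zero_comp]
    have h3 : kernel.lift (cokernel.π (β ≫ ρ)) (t ≫ ρ) h2 ≫ j = t := by
      rw [← cancel_mono ρ, Category.assoc, hj]
      exact kernel.lift_ι _ _ _
    rw [← h3, Category.assoc, hjc, comp_zero]
  exact ⟨w, ⟨KernelFork.IsLimit.ofι _ _ (fun t ht => kernel.lift _ t (key t ht))
    (fun t ht => kernel.lift_ι _ _ _)
    (fun t ht m hm => by
      rw [← cancel_mono (Abelian.image.ι β), hm]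
      exact (kernel.lift_ι _ _ _).symm)⟩⟩
end

section
/- Let A be a semiabelian category and consider a pushout square with morphisms x : X → Y, s : X → Z, t : Y → P, y : Z → P satisfying t∘x = y∘s. Assume that x is strict and that the canonical image monomorphism im x : Im x → Y is a semistable kernel. Then y is strict and im y : Im y → P is a semistable kernel. -/
open CategoryTheory CategoryTheory.Limits

universe v u

variable {C : Type u} [Category.{v} C] [Preadditive C] [HasFiniteBiproducts C]
  [HasKernels C] [HasCokernels C]

/-- In a semiabelian category, in a pushout square `t ∘ x = y ∘ s`,
if `x` is strict and `im x` is a semistable kernel, then `y` is strict and `im y`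
is a semistable kernel. -/
theorem pushout_of_strict_semistable
    (hsemi : ∀ {X Y : C} (f : X ⟶ Y),
      Mono (Abelian.coimageImageComparison f) ∧ Epi (Abelian.coimageImageComparison f))
    {X Y Z P : C} (x : X ⟶ Y) (s : X ⟶ Z) (t : Y ⟶ P) (y : Z ⟶ P)
    (hPO : IsPushout x s t y)
    (hx : IsIso (Abelian.coimageImageComparison x))
    (hxim : SemistableKernel (Abelian.image.ι x)) :
    IsIso (Abelian.coimageImageComparison y) ∧ SemistableKernel (Abelian.image.ι y) := by
  have key : ∃ (Q : C) (q : Z ⟶ Q) (v : Abelian.image x ⟶ Q) (i : Q ⟶ P), q ≫ i = y ∧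
      IsPushout (Abelian.image.ι x) v t i ∧ IsCokernelOf (kernel.ι x ≫ s) q := by
    have hfac : Abelian.factorThruImage x
        = Abelian.coimage.π x ≫ Abelian.coimageImageComparison x := by
      rw [← cancel_mono (Abelian.image.ι x)]
      simp
    let v : Abelian.image x ⟶ cokernel (kernel.ι x ≫ s) :=
      inv (Abelian.coimageImageComparison x) ≫
        cokernel.desc (kernel.ι x) (s ≫ cokernel.π (kernel.ι x ≫ s))
          (by rw [← Category.assoc]; exact cokernel.condition _)
    have hv : Abelian.factorThruImage x ≫ v = s ≫ cokernel.π (kernel.ι x ≫ s) := by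
      rw [hfac]; simp [v]
    have hepi : Epi (Abelian.factorThruImage x) := by rw [hfac]; infer_instance
    have hk : kernel.ι x ≫ Abelian.factorThruImage x = 0 := by
      rw [← cancel_mono (Abelian.image.ι x)]; simp
    have h1 : IsPushout (Abelian.factorThruImage x) s v (cokernel.π (kernel.ι x ≫ s)) := by
      refine ⟨⟨hv⟩, ⟨PushoutCocone.IsColimit.mk _
        (fun c => cokernel.desc _ c.inr ?_) ?_ ?_ ?_⟩⟩
      · rw [Category.assoc, ← c.condition, ← Category.assoc, hk, zero_comp]
      · intro c
        rw [← cancel_epi (Abelian.factorThruImage x), reassoc_of% hv, cokernel.π_desc,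
          c.condition]
      · intro c
        simp
      · intro c m _ h2
        rw [← cancel_epi (cokernel.π (kernel.ι x ≫ s)), h2, cokernel.π_desc]
    have hyw : (kernel.ι x ≫ s) ≫ y = 0 := by
      rw [Category.assoc, ← hPO.w, kernel.condition_assoc, zero_comp]
    refine ⟨_, cokernel.π (kernel.ι x ≫ s), v, cokernel.desc _ y hyw, by simp, ?_,
      ⟨cokernel.condition _, ⟨cokernelIsCokernel _⟩⟩⟩
    refine IsPushout.of_left (h₁₁ := Abelian.factorThruImage x) (v₁₁ := s)
      (h₂₁ := cokernel.π (kernel.ι x ≫ s)) ?_ ?_ h1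
    · simpa using hPO
    · rw [← cancel_epi (Abelian.factorThruImage x), reassoc_of% hv, cokernel.π_desc,
        ← Category.assoc, Abelian.image.fac, hPO.w]
  obtain ⟨Q, q, v, i, hqi, hP2, hw, ⟨hq⟩⟩ := key
  obtain ⟨W, g, hig, ⟨hi⟩⟩ := hxim.2 v t i hP2
  have hqe : Epi q := ⟨fun a b h => Cofork.IsColimit.hom_ext hq h⟩
  have him : Mono i := ⟨fun a b h => Fork.IsLimit.hom_ext hi h⟩
  have hiy : i ≫ cokernel.π y = 0 := by
    rw [← cancel_epi q, reassoc_of% hqi, cokernel.condition, comp_zero]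
  have hyg : y ≫ g = 0 := by rw [← hqi, Category.assoc, hig, comp_zero]
  have hιg : Abelian.image.ι y ≫ g = 0 := by
    rw [← cokernel.π_desc y g hyg, kernel.condition_assoc, zero_comp]
  let j : Q ⟶ Abelian.image y := kernel.lift _ i hiy
  have hj : j ≫ Abelian.image.ι y = i := kernel.lift_ι _ _ _
  obtain ⟨r, hr⟩ : ∃ r : Abelian.image y ⟶ Q, r ≫ i = Abelian.image.ι y :=
    ⟨hi.lift (KernelFork.ofι _ hιg), Fork.IsLimit.lift_ι hi⟩
  have hjiso : IsIso j := ⟨r, by rw [← cancel_mono i, Category.assoc, hr, hj, Category.id_comp],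
    by rw [← cancel_mono (Abelian.image.ι y), Category.assoc, hj, hr, Category.id_comp]⟩
  have hkq : kernel.ι y ≫ q = 0 := by
    rw [← cancel_mono i, Category.assoc, hqi, kernel.condition, zero_comp]
  let p : Abelian.coimage y ⟶ Q := cokernel.desc _ q hkq
  have hp : Abelian.coimage.π y ≫ p = q := cokernel.π_desc _ _ _
  have hyw : (kernel.ι x ≫ s) ≫ y = 0 := by
    rw [Category.assoc, ← hPO.w, kernel.condition_assoc, zero_comp]
  have hkc : (kernel.ι x ≫ s) ≫ Abelian.coimage.π y = 0 := by
    rw [← kernel.lift_ι y _ hyw, Category.assoc, cokernel.condition, comp_zero]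
  obtain ⟨d, hd⟩ : ∃ d : Q ⟶ Abelian.coimage y, q ≫ d = Abelian.coimage.π y :=
    ⟨hq.desc (CokernelCofork.ofπ _ hkc), Cofork.IsColimit.π_desc hq⟩
  have hpiso : IsIso p := ⟨d,
    by rw [← cancel_epi (Abelian.coimage.π y), reassoc_of% hp, hd, Category.comp_id],
    by rw [← cancel_epi q, reassoc_of% hd, hp, Category.comp_id]⟩
  have hcomp : Abelian.coimageImageComparison y = p ≫ j := by
    rw [← cancel_epi (Abelian.coimage.π y), ← cancel_mono (Abelian.image.ι y)]
    simp only [Category.assoc]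
    rw [hj, reassoc_of% hp, hqi, Abelian.coimage_image_factorisation]
  refine ⟨by rw [hcomp]; infer_instance, ⟨_, cokernel.π y, kernel.condition _,
    ⟨kernelIsKernel _⟩⟩, ?_⟩
  intro Z' P' s' t' y' h
  have h3 : IsPushout i j (𝟙 P) (Abelian.image.ι y) :=
    IsPushout.of_vert_isIso ⟨by rw [hj, Category.comp_id]⟩
  exact hxim.2 _ _ _ ((hP2.paste_vert h3).paste_vert h)
end

section
/- Let A be a semiabelian category and consider a pullback square with morphisms x : Y → X, s : Z → X, t : P → Y, y : P → Z satisfying x∘t = s∘y. Assume that x is strict and that the canonical coimage projection coim x : Y → Coim x is a semistable cokernel. Then y is strict and coim y : P → Coim y is a semistable cokernel. -/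
open CategoryTheory CategoryTheory.Limits

universe v u

variable {C : Type u} [Category.{v} C] [Preadditive C] [HasFiniteBiproducts C]
  [HasKernels C] [HasCokernels C]

/-- In a semiabelian category, in a pullback square `x ∘ t = s ∘ y`,
if `x` is strict and `coim x` is a semistable cokernel, then `y` is strict and `coim y`
is a semistable cokernel. -/
theorem pullback_of_strict_semistable
    (hsemi : ∀ {X Y : C} (f : X ⟶ Y),
      Mono (Abelian.coimageImageComparison f) ∧ Epi (Abelian.coimageImageComparison f))
    {X Y Z P : C} (x : Y ⟶ X) (s : Z ⟶ X) (t : P ⟶ Y) (y : P ⟶ Z)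
    (hPB : IsPullback t y x s)
    (hx : IsIso (Abelian.coimageImageComparison x))
    (hxcoim : SemistableCokernel (Abelian.coimage.π x)) :
    IsIso (Abelian.coimageImageComparison y) ∧ SemistableCokernel (Abelian.coimage.π y) := by
  haveI := hx
  have hxg : x ≫ cokernel.π x = 0 := cokernel.condition x
  let g := s ≫ cokernel.π x
  let c := Abelian.coimageImageComparison x
  let i := c ≫ Abelian.image.ι x
  have hi : Abelian.coimage.π x ≫ i = x := Abelian.coimage_image_factorisation x
  haveI : Mono i := mono_comp c _
  have hig : i ≫ cokernel.π x = 0 := by simp [i]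
  let s' : kernel g ⟶ Abelian.coimage x :=
    kernel.lift (cokernel.π x) (kernel.ι g ≫ s) (by simpa [g] using kernel.condition g) ≫ inv c
  have hs' : s' ≫ i = kernel.ι g ≫ s := by simp [s', i]
  have sq : IsPullback s' (kernel.ι g) i s := by
    refine ⟨⟨hs'⟩, ⟨PullbackCone.IsLimit.mk hs'
      (fun q => kernel.lift g q.snd ?_) (fun q => ?_) (fun q => ?_) (fun q m h₁ h₂ => ?_)⟩⟩
    · simp only [g]
      rw [← Category.assoc, ← q.condition, Category.assoc, hig, comp_zero]
    · rw [← cancel_mono i, Category.assoc, hs', kernel.lift_ι_assoc, q.condition]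
    · simp
    · rw [← cancel_mono (kernel.ι g), h₂, kernel.lift_ι]
  let p : P ⟶ kernel g := kernel.lift g y (by
    simp only [g]
    rw [← Category.assoc, ← hPB.w, Category.assoc, hxg, comp_zero])
  have hp : p ≫ kernel.ι g = y := kernel.lift_ι _ _ _
  have top : IsPullback t p (Abelian.coimage.π x) s' := by
    refine IsPullback.of_bot (v₂₁ := kernel.ι g) (v₂₂ := i) (h₃₁ := s) ?_ ?_ sq
    · rw [hp, hi]; exact hPB
    · rw [← cancel_mono i, Category.assoc, Category.assoc, hi, hs', ← Category.assoc p, hp, hPB.w]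
  obtain ⟨W, k, hk, ⟨hcol⟩⟩ := hxcoim.2 t p s' top
  haveI : Epi p := Cofork.IsColimit.epi hcol
  have hky : k ≫ y = 0 := by rw [← hp, ← Category.assoc, hk, zero_comp]
  have hkc : k ≫ Abelian.coimage.π y = 0 := by
    have h : kernel.lift y k hky ≫ kernel.ι y = k := kernel.lift_ι _ _ _
    rw [← h, Category.assoc, cokernel.condition, comp_zero]
  have hyp : kernel.ι y ≫ p = 0 := by
    rw [← cancel_mono (kernel.ι g), Category.assoc, hp, kernel.condition, zero_comp]
  let e : Abelian.coimage y ⟶ kernel g := cokernel.desc (kernel.ι y) p hyp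
  have he : Abelian.coimage.π y ≫ e = p := cokernel.π_desc _ _ _
  obtain ⟨e', he'⟩ : ∃ e' : kernel g ⟶ Abelian.coimage y, p ≫ e' = Abelian.coimage.π y :=
    ⟨_, (CokernelCofork.IsColimit.desc' hcol _ hkc).2⟩
  have ee' : e ≫ e' = 𝟙 _ := by
    rw [← cancel_epi (Abelian.coimage.π y), ← Category.assoc, he, he', Category.comp_id]
  have e'e : e' ≫ e = 𝟙 _ := by
    rw [← cancel_epi p, ← Category.assoc, he', he, Category.comp_id]
  haveI : IsIso e := ⟨e', ee', e'e⟩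
  have hyg : y ≫ g = 0 := by rw [← hp, Category.assoc, kernel.condition, comp_zero]
  let m : kernel g ⟶ Abelian.image y := kernel.lift (cokernel.π y) (kernel.ι g) (by
    rw [← cancel_epi p, ← Category.assoc, hp, cokernel.condition, comp_zero])
  have hm : m ≫ Abelian.image.ι y = kernel.ι g := kernel.lift_ι _ _ _
  let m' : Abelian.image y ⟶ kernel g := kernel.lift g (Abelian.image.ι y) (by
    have h : cokernel.π y ≫ cokernel.desc y g hyg = g := cokernel.π_desc _ _ _
    rw [← h, ← Category.assoc, kernel.condition, zero_comp])
  have hm' : m' ≫ kernel.ι g = Abelian.image.ι y := kernel.lift_ι _ _ _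
  haveI : IsIso m := ⟨m', by
      rw [← cancel_mono (kernel.ι g), Category.assoc, hm', hm, Category.id_comp], by
      rw [← cancel_mono (Abelian.image.ι y), Category.assoc, hm, hm', Category.id_comp]⟩
  refine ⟨?_, ⟨_, _, cokernel.condition (kernel.ι y), ⟨cokernelIsCokernel (kernel.ι y)⟩⟩, ?_⟩
  · have : Abelian.coimageImageComparison y = e ≫ m := by
      rw [← cancel_mono (Abelian.image.ι y), ← cancel_epi (Abelian.coimage.π y),
        Abelian.coimage_image_factorisation, Category.assoc, hm, ← Category.assoc, he, hp]
    rw [this]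
    infer_instance
  · intro P' Z' t' y' s'' h
    have h2 : IsPullback (𝟙 P) (Abelian.coimage.π y) p e :=
      IsPullback.of_horiz_isIso ⟨by rw [Category.id_comp, he]⟩
    exact hxcoim.2 _ y' _ ((h.paste_horiz h2).paste_horiz top)
end

section
/- Let A be a semiabelian category and let α : D → D, β : D → E, γ : E → D be an exact couple in which α, β and γ are strict. Perform the left Eckmann–Hilton construction, producing D₁, E_ρ, E₁⁻ and the morphisms σ, ρ, ρ′, γ′, β′, σ′, β₁⁻, γ₁⁻, α₁ = σ∘ρ. Then the diagram α₁ : D₁ → D₁, β₁⁻ : D₁ → E₁⁻, γ₁⁻ : E₁⁻ → D₁ is again an exact couple, i.e., im α₁ = ker β₁⁻, im β₁⁻ = ker γ₁⁻ and im γ₁⁻ = ker α₁. -/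
open CategoryTheory CategoryTheory.Limits

universe v u

variable {C : Type u} [Category.{v} C] [Preadditive C] [HasFiniteBiproducts C]
  [HasKernels C] [HasCokernels C]

lemma isKernelOf_image {X Y Z : C} (f : X ⟶ Y) (g : Y ⟶ Z)
    (h : ∀ {T : C} (t : T ⟶ Y), t ≫ g = 0 ↔ t ≫ cokernel.π f = 0) :
    IsKernelOf (Abelian.image.ι f) g := by
  have w : Abelian.image.ι f ≫ g = 0 := (h _).2 (kernel.condition _)
  refine ⟨w, ⟨KernelFork.IsLimit.ofι _ _
    (fun t ht => kernel.lift (cokernel.π f) t ((h t).1 ht)) ?_ ?_⟩⟩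
  · intro T t ht
    exact kernel.lift_ι _ _ _
  · intro T t ht s hs
    rw [← cancel_mono (Abelian.image.ι f), hs]
    exact (kernel.lift_ι _ _ _).symm

lemma IsKernelOf.lift {X Y Z : C} {i : X ⟶ Y} {g : Y ⟶ Z} (h : IsKernelOf i g)
    {T : C} (t : T ⟶ Y) (ht : t ≫ g = 0) : ∃ s : T ⟶ X, s ≫ i = t := by
  obtain ⟨w, ⟨hl⟩⟩ := h
  obtain ⟨s, hs⟩ := KernelFork.IsLimit.lift' hl t ht
  exact ⟨s, hs⟩

lemma IsKernelOf.mono {X Y Z : C} {i : X ⟶ Y} {g : Y ⟶ Z} (h : IsKernelOf i g) : Mono i := by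
  obtain ⟨w, ⟨hl⟩⟩ := h
  exact mono_of_isLimit_fork hl

lemma IsCokernelOf.epi {X Y Z : C} {g : X ⟶ Y} {p : Y ⟶ Z} (h : IsCokernelOf g p) : Epi p := by
  obtain ⟨w, ⟨hl⟩⟩ := h
  exact epi_of_isColimit_cofork hl

/-- In a right semiabelian category, a pushout of a kernel is monic. -/
lemma mono_of_pushout_kernel [HasBinaryBiproducts C]
    (hsemi : ∀ {X Y : C} (f : X ⟶ Y), Epi (Abelian.coimageImageComparison f))
    {X Y Z P K : C} (f : X ⟶ Y) (k : Y ⟶ K) (hf : IsKernelOf f k)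
    (g : X ⟶ Z) (j : Z ⟶ P)
    (hP : ∀ {T : C} (a : Y ⟶ T) (b : Z ⟶ T), f ≫ a = g ≫ b → ∃ c : P ⟶ T, j ≫ c = b) :
    Mono j := by
  have := hf.mono
  let φ : X ⟶ Y ⊞ Z := biprod.lift f (-g)
  let e : X ⟶ Abelian.image φ := Abelian.coimage.π φ ≫ Abelian.coimageImageComparison φ
  have he : e ≫ Abelian.image.ι φ = φ := by
    simp only [e, Category.assoc]; exact Abelian.coimage_image_factorisation φ
  have : Epi e := by
    have := hsemi φ
    exact epi_comp _ _
  obtain ⟨r, hr⟩ := hf.lift (Abelian.image.ι φ ≫ biprod.fst) (by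
    rw [← cancel_epi e, ← Category.assoc e, ← Category.assoc e, he, comp_zero]
    simp only [φ, biprod.lift_fst]
    exact hf.1)
  have her : e ≫ r = 𝟙 X := by
    rw [← cancel_mono f, Category.assoc, hr, ← Category.assoc, he]
    simp [φ]
  have hrg : r ≫ (-g) = Abelian.image.ι φ ≫ biprod.snd := by
    rw [← cancel_epi e, ← Category.assoc, her, ← Category.assoc, he]
    simp [φ]
  refine Preadditive.mono_of_cancel_zero _ fun {T} u hu => ?_
  obtain ⟨c, hc⟩ := hP (biprod.inl ≫ cokernel.π φ) (biprod.inr ≫ cokernel.π φ) (by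
    have h0 := cokernel.condition φ
    have h1 : φ = f ≫ biprod.inl - g ≫ biprod.inr := by
      apply biprod.hom_ext <;> simp [φ]
    have h2 : (f ≫ biprod.inl - g ≫ biprod.inr) ≫ cokernel.π φ = 0 := by
      rw [← h1]; exact h0
    rw [Preadditive.sub_comp, sub_eq_zero] at h2
    simpa using h2)
  have hv : (u ≫ biprod.inr) ≫ cokernel.π φ = 0 := by
    rw [Category.assoc, ← hc, ← Category.assoc, hu, zero_comp]
  let v : T ⟶ Abelian.image φ := kernel.lift (cokernel.π φ) (u ≫ biprod.inr) hv
  have hv' : v ≫ Abelian.image.ι φ = u ≫ biprod.inr := kernel.lift_ι _ _ _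
  have hvr : v ≫ r = 0 := by
    rw [← cancel_mono f, Category.assoc, hr, ← Category.assoc, hv']
    simp
  calc u = (u ≫ biprod.inr) ≫ (biprod.snd : Y ⊞ Z ⟶ Z) := by simp
    _ = v ≫ r ≫ (-g) := by rw [← hv', Category.assoc, hrg]
    _ = 0 := by rw [← Category.assoc, hvr, zero_comp]

/-- In a left semiabelian category, a pullback of a cokernel is epic. -/
lemma epi_of_pullback_coimage [HasBinaryBiproducts C]
    (hsemi : ∀ {X Y : C} (f : X ⟶ Y), Mono (Abelian.coimageImageComparison f))
    {W X Y Z : C} (h : X ⟶ Y) (d : Y ⟶ Z) (f : W ⟶ Z) (w : h ≫ d = 0) [Epi d]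
    (hd : ∀ {T : C} (t : Y ⟶ T), h ≫ t = 0 → ∃ s : Z ⟶ T, d ≫ s = t) :
    Epi (kernel.ι (biprod.desc f (-d)) ≫ biprod.fst) := by
  let ψ : W ⊞ Y ⟶ Z := biprod.desc f (-d)
  let p := Abelian.coimage.π ψ
  let m : Abelian.coimage ψ ⟶ Z := Abelian.coimageImageComparison ψ ≫ Abelian.image.ι ψ
  have hpm : p ≫ m = ψ := Abelian.coimage_image_factorisation ψ
  have : Mono m := by
    have := hsemi ψ
    exact mono_comp _ _
  obtain ⟨r, hr⟩ := hd (biprod.inr ≫ p) (by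
    rw [← cancel_mono m]
    simp [hpm, ψ, w])
  have hrm : r ≫ m = -𝟙 Z := by
    rw [← cancel_epi d, ← Category.assoc, hr, Category.assoc, hpm]
    simp [ψ]
  have hinl : biprod.inl ≫ p = -(f ≫ r) := by
    rw [← cancel_mono m, Category.assoc, hpm]
    simp [ψ, hrm]
  refine Preadditive.epi_of_cancel_zero _ fun {Q} q hq => ?_
  let v : Abelian.coimage ψ ⟶ Q := cokernel.desc (kernel.ι ψ) (biprod.fst ≫ q) (by
    rw [← Category.assoc]; exact hq)
  have hv : p ≫ v = biprod.fst ≫ q := cokernel.π_desc _ _ _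
  have hrv : r ≫ v = 0 := by
    rw [← cancel_epi d, ← Category.assoc, hr, Category.assoc, hv]
    simp
  calc q = biprod.inl ≫ (biprod.fst : W ⊞ Y ⟶ W) ≫ q := by simp
    _ = (biprod.inl ≫ p) ≫ v := by rw [← hv, Category.assoc]
    _ = 0 := by rw [hinl, Preadditive.neg_comp, Category.assoc, hrv]; simp

/-- For strict `f`, the map to the image is a cokernel of the kernel of `f`. -/
lemma strict_desc {X Y : C} (f : X ⟶ Y) [IsIso (Abelian.coimageImageComparison f)]
    {T : C} (t : X ⟶ T) (ht : kernel.ι f ≫ t = 0) :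
    ∃ s : Abelian.image f ⟶ T, Abelian.factorThruImage f ≫ s = t := by
  have h : Abelian.factorThruImage f =
      Abelian.coimage.π f ≫ Abelian.coimageImageComparison f := by
    rw [← cancel_mono (Abelian.image.ι f), Abelian.image.fac, Category.assoc,
      Abelian.coimage_image_factorisation]
  refine ⟨inv (Abelian.coimageImageComparison f) ≫ cokernel.desc _ t ht, ?_⟩
  rw [h]
  simp only [Category.assoc, IsIso.hom_inv_id_assoc]
  exact cokernel.π_desc _ _ _

lemma strict_epi {X Y : C} (f : X ⟶ Y) [IsIso (Abelian.coimageImageComparison f)] :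
    Epi (Abelian.factorThruImage f) := by
  have h : Abelian.factorThruImage f =
      Abelian.coimage.π f ≫ Abelian.coimageImageComparison f := by
    rw [← cancel_mono (Abelian.image.ι f), Abelian.image.fac, Category.assoc,
      Abelian.coimage_image_factorisation]
  rw [h]
  exact epi_comp _ _

/-- The left derived couple of a strict exact couple in a semiabelian
category is again an exact couple: with α₁ = σ∘ρ = ρ ≫ σ we have im α₁ = ker β₁⁻,
im β₁⁻ = ker γ₁⁻ and im γ₁⁻ = ker α₁. -/
theorem left_derived_couple_exact
    (hsemi : ∀ {X Y : C} (f : X ⟶ Y),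
      Mono (Abelian.coimageImageComparison f) ∧ Epi (Abelian.coimageImageComparison f))
    -- the exact couple, with all three morphisms strict
    {D E D₁ Eρ E₁m : C} (α : D ⟶ D) (β : D ⟶ E) (γ : E ⟶ D)
    (hc1 : IsKernelOf (Abelian.image.ι α) β)
    (hc2 : IsKernelOf (Abelian.image.ι β) γ)
    (hc3 : IsKernelOf (Abelian.image.ι γ) α)
    (hsα : IsIso (Abelian.coimageImageComparison α))
    (hsβ : IsIso (Abelian.coimageImageComparison β))
    (hsγ : IsIso (Abelian.coimageImageComparison γ))
    -- the strict factorization α = ρ ∘ σ with σ = cok γ and ρ = ker β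
    (σ : D ⟶ D₁) (ρ : D₁ ⟶ D)
    (hσ : IsCokernelOf γ σ) (hρ : IsKernelOf ρ β) (hα : σ ≫ ρ = α)
    -- left construction: pullback of γ along ρ
    (ρ' : Eρ ⟶ E) (γ' : Eρ ⟶ D₁) (hPB : IsPullback ρ' γ' γ ρ)
    (β' : D ⟶ Eρ) (hβ' : β' ≫ ρ' = β) (hβ'0 : β' ≫ γ' = 0)
    -- left construction: pushout of β' along σ
    (σ' : Eρ ⟶ E₁m) (β₁m : D₁ ⟶ E₁m) (hPO : IsPushout β' σ σ' β₁m)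
    (γ₁m : E₁m ⟶ D₁) (hγ₁ : σ' ≫ γ₁m = γ') (hγ₁0 : β₁m ≫ γ₁m = 0)
    :
    IsKernelOf (Abelian.image.ι (ρ ≫ σ)) β₁m ∧
    IsKernelOf (Abelian.image.ι β₁m) γ₁m ∧
    IsKernelOf (Abelian.image.ι γ₁m) (ρ ≫ σ) := by
  have hbb : HasBinaryBiproducts C := hasBinaryBiproducts_of_finite_biproducts C
  have hσepi : Epi σ := hσ.epi
  have hρmono : Mono ρ := hρ.mono
  have hqepi := strict_epi β
  have hpepi := strict_epi γ
  have hσ'epi : Epi σ' := by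
    refine Preadditive.epi_of_cancel_zero _ fun {Q} q hq => ?_
    apply hPO.hom_ext
    · rw [hq, comp_zero]
    · rw [comp_zero, ← cancel_epi σ, ← Category.assoc, ← hPO.w, Category.assoc, hq]
      simp
  -- the kernel of `γ'`
  obtain ⟨i', hi'ρ, hi'γ⟩ : ∃ i' : Abelian.image β ⟶ Eρ,
      i' ≫ ρ' = Abelian.image.ι β ∧ i' ≫ γ' = 0 :=
    ⟨hPB.lift (Abelian.image.ι β) 0 (by rw [hc2.1, zero_comp]), by simp, by simp⟩
  have hqi' : Abelian.factorThruImage β ≫ i' = β' := by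
    apply hPB.hom_ext
    · rw [Category.assoc, hi'ρ, hβ', Abelian.image.fac]
    · rw [Category.assoc, hi'γ, hβ'0, comp_zero]
  have hi'mono : Mono i' := by
    have : Mono (i' ≫ ρ') := by rw [hi'ρ]; infer_instance
    exact mono_of_mono i' ρ'
  have hi'lift : ∀ {T : C} (t : T ⟶ Eρ), t ≫ γ' = 0 → ∃ s, s ≫ i' = t := by
    intro T t ht
    obtain ⟨s, hs⟩ := hc2.lift (t ≫ ρ') (by
      rw [Category.assoc, hPB.w, ← Category.assoc, ht, zero_comp])
    refine ⟨s, hPB.hom_ext ?_ ?_⟩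
    · rw [Category.assoc, hi'ρ, hs]
    · rw [Category.assoc, hi'γ, ht, comp_zero]
  have hi'ker : IsKernelOf i' γ' := by
    refine ⟨hi'γ, ⟨KernelFork.IsLimit.ofι _ _
      (fun t ht => (hi'lift t ht).choose) (fun t ht => (hi'lift t ht).choose_spec) ?_⟩⟩
    intro T t ht s hs
    rw [← cancel_mono i', hs, (hi'lift t ht).choose_spec]
  refine ⟨isKernelOf_image _ _ ?_, isKernelOf_image _ _ ?_, isKernelOf_image _ _ ?_⟩
  · -- exactness of `α₁, β₁`
    have hρβ' : ρ ≫ β' = 0 := by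
      apply hPB.hom_ext
      · rw [Category.assoc, hβ', hρ.1, zero_comp]
      · rw [Category.assoc, hβ'0, comp_zero, zero_comp]
    have hαβ : (ρ ≫ σ) ≫ β₁m = 0 := by
      rw [Category.assoc, ← hPO.w, ← Category.assoc, hρβ', zero_comp]
    have hj : cokernel.π (ρ ≫ σ) ≫ cokernel.desc _ β₁m hαβ = β₁m := cokernel.π_desc _ _ _
    obtain ⟨n, hn⟩ := strict_desc β (σ ≫ cokernel.π (ρ ≫ σ)) (by
      obtain ⟨s, hs⟩ := hρ.lift (kernel.ι β) (kernel.condition β)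
      have h0 := cokernel.condition (ρ ≫ σ)
      rw [Category.assoc] at h0
      rw [← hs, Category.assoc, h0, comp_zero])
    have hjmono : Mono (cokernel.desc (ρ ≫ σ) β₁m hαβ) := by
      refine mono_of_pushout_kernel (fun f => (hsemi f).2) i' γ' hi'ker n _ ?_
      intro T a b hab
      have hw : β' ≫ a = σ ≫ cokernel.π (ρ ≫ σ) ≫ b := by
        rw [← hqi', Category.assoc, hab, ← Category.assoc, hn, Category.assoc]
      refine ⟨hPO.desc a (cokernel.π (ρ ≫ σ) ≫ b) hw, ?_⟩
      rw [← cancel_epi (cokernel.π (ρ ≫ σ)), ← Category.assoc, hj, hPO.inr_desc]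
    intro T t
    rw [← cancel_mono (cokernel.desc (ρ ≫ σ) β₁m hαβ), Category.assoc, hj, zero_comp]
  · -- exactness of `β₁, γ₁`
    intro T t
    constructor
    · intro ht
      let m : Abelian.coimage γ' ⟶ D₁ :=
        Abelian.coimageImageComparison γ' ≫ Abelian.image.ι γ'
      have hm : Abelian.coimage.π γ' ≫ m = γ' := Abelian.coimage_image_factorisation γ'
      have hmmono : Mono m := by
        have := (hsemi γ').1
        exact mono_comp _ _
      obtain ⟨d, hd1, hd2⟩ : ∃ d : E₁m ⟶ Abelian.coimage γ',
          σ' ≫ d = Abelian.coimage.π γ' ∧ β₁m ≫ d = 0 :=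
        ⟨hPO.desc (Abelian.coimage.π γ') 0 (by
          rw [← cancel_mono m, Category.assoc, hm, hβ'0]; simp), by simp, by simp⟩
      have hdm : d ≫ m = γ₁m := by
        apply hPO.hom_ext
        · rw [← Category.assoc, hd1, hm, hγ₁]
        · rw [← Category.assoc, hd2, hγ₁0, zero_comp]
      have htd : t ≫ d = 0 := by
        rw [← cancel_mono m, Category.assoc, hdm, ht, zero_comp]
      have hk : kernel.ι γ' ≫ σ' ≫ cokernel.π β₁m = 0 := by
        obtain ⟨s, hs⟩ := hi'lift (kernel.ι γ') (kernel.condition γ')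
        have h1 : i' ≫ σ' ≫ cokernel.π β₁m = 0 := by
          rw [← cancel_epi (Abelian.factorThruImage β), ← Category.assoc, hqi',
            ← Category.assoc, hPO.w, Category.assoc, cokernel.condition]
          simp
        rw [← hs, Category.assoc, h1, comp_zero]
      have hc : d ≫ cokernel.desc _ (σ' ≫ cokernel.π β₁m) hk = cokernel.π β₁m := by
        rw [← cancel_epi σ', ← Category.assoc, hd1]
        exact cokernel.π_desc _ _ _
      rw [← hc, ← Category.assoc, htd, zero_comp]
    · intro ht
      rw [← cokernel.π_desc β₁m γ₁m hγ₁0, ← Category.assoc, ht, zero_comp]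
  · -- exactness of `γ₁, α₁`
    intro T t
    constructor
    · intro ht
      obtain ⟨k, hk⟩ := hc3.lift (t ≫ ρ) (by
        rw [← hα]
        rw [Category.assoc, ← Category.assoc ρ, ← Category.assoc, ht, zero_comp])
      have hs := epi_of_pullback_coimage (fun f => (hsemi f).1) (kernel.ι γ)
        (Abelian.factorThruImage γ) k
        (by rw [← cancel_mono (Abelian.image.ι γ), Category.assoc, Abelian.image.fac,
              kernel.condition, zero_comp])
        (fun t ht => strict_desc γ t ht)
      have hw := kernel.condition (biprod.desc k (-Abelian.factorThruImage γ))
      generalize kernel.ι (biprod.desc k (-Abelian.factorThruImage γ)) = κ at hs hw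
      generalize kernel (biprod.desc k (-Abelian.factorThruImage γ)) = K at κ hs hw
      have hw' : (κ ≫ biprod.snd) ≫ Abelian.factorThruImage γ = (κ ≫ biprod.fst) ≫ k := by
        rw [biprod.desc_eq, Preadditive.comp_add] at hw
        simp only [Preadditive.comp_neg, ← sub_eq_add_neg, sub_eq_zero] at hw
        simpa using hw.symm
      have hw2 : (κ ≫ biprod.snd) ≫ γ = ((κ ≫ biprod.fst) ≫ t) ≫ ρ := by
        rw [Category.assoc _ t, ← hk, ← Category.assoc _ k, ← hw', Category.assoc _ _ (Abelian.image.ι γ),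
          Abelian.image.fac]
      obtain ⟨z, hz⟩ : ∃ z, z ≫ γ' = (κ ≫ biprod.fst) ≫ t := ⟨_, hPB.lift_snd _ _ hw2⟩
      rw [← cancel_epi (κ ≫ biprod.fst), ← Category.assoc, ← hz, ← hγ₁]
      simp
    · intro ht
      have h0 : γ₁m ≫ ρ ≫ σ = 0 := by
        rw [← cancel_epi σ', ← Category.assoc, hγ₁, ← Category.assoc, ← hPB.w, Category.assoc,
          hσ.1]
        simp
      rw [← cokernel.π_desc γ₁m (ρ ≫ σ) h0, ← Category.assoc, ht, zero_comp]
end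

section
/- Let A be a semiabelian category and let α : D → D, β : D → E, γ : E → D be an exact couple in which α, β and γ are strict. Perform the right Eckmann–Hilton construction, producing D₁, E^σ, E₁⁺ and the morphisms σ, ρ, σ″, β″, γ″, ρ″, γ₁⁺, β₁⁺, α₁ = σ∘ρ. Then the diagram α₁ : D₁ → D₁, β₁⁺ : D₁ → E₁⁺, γ₁⁺ : E₁⁺ → D₁ is again an exact couple, i.e., im α₁ = ker β₁⁺, im β₁⁺ = ker γ₁⁺ and im γ₁⁺ = ker α₁. -/
open CategoryTheory CategoryTheory.Limits

universe v u

variable {C : Type u} [Category.{v} C] [Preadditive C] [HasFiniteBiproducts C]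
  [HasKernels C] [HasCokernels C]

theorem isKernelOf_lift {X Y Z W : C} {ι : X ⟶ Y} {g : Y ⟶ Z} (h : IsKernelOf ι g)
    (z : W ⟶ Y) (hz : z ≫ g = 0) : ∃ l : W ⟶ X, l ≫ ι = z := by
  obtain ⟨w, ⟨hl⟩⟩ := h
  exact ⟨hl.lift (KernelFork.ofι z hz), hl.fac (KernelFork.ofι z hz) WalkingParallelPair.zero⟩

theorem isKernelOf_mk {X Y Z : C} {ι : X ⟶ Y} {g : Y ⟶ Z} [Mono ι] (w : ι ≫ g = 0)
    (h : ∀ {W : C} (z : W ⟶ Y), z ≫ g = 0 → ∃ l : W ⟶ X, l ≫ ι = z) : IsKernelOf ι g := by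
  refine ⟨w, ⟨KernelFork.IsLimit.ofι' ι w (fun {A} z hz => ⟨(h z hz).choose, (h z hz).choose_spec⟩)⟩⟩

/-- If `f = e ≫ k` with `e` epi and `k` a (weak) kernel of `g`, then `im f = ker g`. -/
theorem isKernelOf_image_s6 {X K Y Z : C} (f : X ⟶ Y) (g : Y ⟶ Z) (e : X ⟶ K) (k : K ⟶ Y)
    [Epi e] (hf : e ≫ k = f) (hk : k ≫ g = 0)
    (h : ∀ {W : C} (z : W ⟶ Y), z ≫ g = 0 → ∃ l : W ⟶ K, l ≫ k = z) :
    IsKernelOf (Abelian.image.ι f) g := by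
  have hfg : f ≫ g = 0 := by rw [← hf, Category.assoc, hk, comp_zero]
  refine isKernelOf_mk ?_ ?_
  · rw [← cokernel.π_desc f g hfg, kernel.condition_assoc, zero_comp]
  · intro W z hz
    obtain ⟨l, rfl⟩ := h z hz
    have hkc : k ≫ cokernel.π f = 0 := by
      rw [← cancel_epi e, ← Category.assoc, hf, cokernel.condition, comp_zero]
    exact ⟨kernel.lift _ (l ≫ k) (by rw [Category.assoc, hkc, comp_zero]), kernel.lift_ι _ _ _⟩

theorem semi_epi {X Y : C} (f : X ⟶ Y) (h : Epi (Abelian.coimageImageComparison f)) :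
    Epi (Abelian.factorThruImage f) := by
  have : Abelian.factorThruImage f = Abelian.coimage.π f ≫ Abelian.coimageImageComparison f := by
    simp [Abelian.coimageImageComparison]
  rw [this]
  exact epi_comp _ _

theorem semi_mono {X Y : C} (f : X ⟶ Y) (h : Mono (Abelian.coimageImageComparison f)) :
    Mono (Abelian.factorThruCoimage f) := by
  have : Abelian.factorThruCoimage f = Abelian.coimageImageComparison f ≫ Abelian.image.ι f := by
    ext
    simp [Abelian.coimageImageComparison]
  rw [this]
  exact mono_comp _ _

/-- In a semiabelian category pushouts of kernels are monomorphisms. -/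
theorem mono_of_pushout_kernel_s6
    (hsemi : ∀ {X Y : C} (f : X ⟶ Y), Epi (Abelian.factorThruImage f))
    {I E J Q P : C} (i : I ⟶ E) [Mono i] (k : E ⟶ J) (hik : i ≫ k = 0)
    (hk : ∀ {W : C} (z : W ⟶ E), z ≫ k = 0 → ∃ l : W ⟶ I, l ≫ i = z)
    (s : I ⟶ Q) (d : Q ⟶ P)
    (hP : ∀ {T : C} (a : E ⟶ T) (b : Q ⟶ T), i ≫ a = s ≫ b → ∃ l : P ⟶ T, d ≫ l = b) :
    Mono d := by
  refine Preadditive.mono_of_cancel_zero _ fun {Z} z hz => ?_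
  have := HasBinaryBiproducts.of_hasBinaryProducts (C := C)
  let f : I ⟶ E ⊞ Q := biprod.lift i (-s)
  let e := Abelian.factorThruImage f
  let m := Abelian.image.ι f
  haveI : Epi e := hsemi f
  have hem : e ≫ m = f := Abelian.image.fac f
  obtain ⟨l, hl⟩ := hP (biprod.inl ≫ cokernel.π f) (biprod.inr ≫ cokernel.π f) (by
    have := cokernel.condition f
    have hf : f = i ≫ biprod.inl - s ≫ biprod.inr := by
      apply biprod.hom_ext <;> simp [f]
    have h2 : (i ≫ biprod.inl - s ≫ biprod.inr) ≫ cokernel.π f = 0 := by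
      rw [← hf]; exact this
    rw [Preadditive.sub_comp, sub_eq_zero] at h2
    simpa using h2)
  have hz' : (z ≫ biprod.inr) ≫ cokernel.π f = 0 := by
    rw [Category.assoc, ← hl, ← Category.assoc, hz, zero_comp]
  let w : Z ⟶ Abelian.image f := kernel.lift _ _ hz'
  have hw : w ≫ m = z ≫ biprod.inr := kernel.lift_ι _ _ _
  have h0 : (m ≫ biprod.fst) ≫ k = 0 := by
    rw [← cancel_epi e, ← Category.assoc, ← Category.assoc, hem]
    simp [f, hik]
  obtain ⟨t, ht⟩ := hk _ h0
  have het : e ≫ t = 𝟙 _ := by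
    rw [← cancel_mono i, Category.assoc, ht, ← Category.assoc, hem]
    simp [f]
  have hte : t ≫ e = 𝟙 _ := by
    rw [← cancel_epi e, ← Category.assoc, het]; simp
  have hwt : w ≫ t = 0 := by
    rw [← cancel_mono i, Category.assoc, ht, ← Category.assoc, hw]
    simp
  have hw0 : w = 0 := by
    rw [← Category.comp_id w, ← hte, ← Category.assoc, hwt, zero_comp]
  have : z = (z ≫ biprod.inr) ≫ (biprod.snd : E ⊞ Q ⟶ Q) := by simp
  rw [this, ← hw, hw0]; simp

/-- In a semiabelian category pullbacks of cokernels are epimorphisms. -/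
theorem epi_of_pullback_cokernel
    (hsemi : ∀ {X Y : C} (f : X ⟶ Y), Mono (Abelian.factorThruCoimage f))
    {Y Q J Z P : C} (p : Y ⟶ Q) [Epi p] (k : J ⟶ Y) (hkp : k ≫ p = 0)
    (hk : ∀ {W : C} (z : Y ⟶ W), k ≫ z = 0 → ∃ l : Q ⟶ W, p ≫ l = z)
    (s : Z ⟶ Q) (y : P ⟶ Z)
    (hP : ∀ {T : C} (a : T ⟶ Y) (b : T ⟶ Z), a ≫ p = b ≫ s → ∃ l : T ⟶ P, l ≫ y = b) :
    Epi y := by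
  refine Preadditive.epi_of_cancel_zero _ fun {T} z hz => ?_
  have := HasBinaryBiproducts.of_hasBinaryProducts (C := C)
  let f : Y ⊞ Z ⟶ Q := biprod.desc p (-s)
  let e := Abelian.coimage.π f
  let m := Abelian.factorThruCoimage f
  haveI : Mono m := hsemi f
  have hem : e ≫ m = f := Abelian.coimage.fac f
  obtain ⟨l, hl⟩ := hP (kernel.ι f ≫ biprod.fst) (kernel.ι f ≫ biprod.snd) (by
    have := kernel.condition f
    have hf : f = biprod.fst ≫ p - biprod.snd ≫ s := by
      apply biprod.hom_ext' <;> simp [f]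
    have h2 : kernel.ι f ≫ (biprod.fst ≫ p - biprod.snd ≫ s) = 0 := by
      rw [← hf]; exact this
    rw [Preadditive.comp_sub, sub_eq_zero] at h2
    simpa using h2)
  have hz' : kernel.ι f ≫ (biprod.snd ≫ z) = 0 := by
    rw [← Category.assoc, ← hl, Category.assoc, hz, comp_zero]
  let w : Abelian.coimage f ⟶ T := cokernel.desc _ _ hz'
  have hw : e ≫ w = biprod.snd ≫ z := cokernel.π_desc _ _ _
  have h0 : k ≫ (biprod.inl ≫ e) = 0 := by
    rw [← cancel_mono m, Category.assoc, Category.assoc, hem]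
    simp [f, hkp]
  obtain ⟨t, ht⟩ := hk _ h0
  have het : t ≫ m = 𝟙 _ := by
    rw [← cancel_epi p, ← Category.assoc, ht, Category.assoc, hem]
    simp [f]
  have hte : m ≫ t = 𝟙 _ := by
    rw [← cancel_mono m, Category.assoc, het]; simp
  have hwt : t ≫ w = 0 := by
    rw [← cancel_epi p, ← Category.assoc, ht, Category.assoc, hw]
    simp
  have hw0 : w = 0 := by
    rw [← Category.id_comp w, ← hte, Category.assoc, hwt, comp_zero]
  have : z = (biprod.inr : Z ⟶ Y ⊞ Z) ≫ (biprod.snd ≫ z) := by simp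
  rw [this, ← hw, hw0]; simp

/-- The right derived couple of a strict exact couple in a semiabelian
category is again an exact couple: with α₁ = σ∘ρ = ρ ≫ σ we have im α₁ = ker β₁⁺,
im β₁⁺ = ker γ₁⁺ and im γ₁⁺ = ker α₁. -/
theorem right_derived_couple_exact
    (hsemi : ∀ {X Y : C} (f : X ⟶ Y),
      Mono (Abelian.coimageImageComparison f) ∧ Epi (Abelian.coimageImageComparison f))
    -- the exact couple, with all three morphisms strict
    {D E D₁ : C} (α : D ⟶ D) (β : D ⟶ E) (γ : E ⟶ D)
    (hc1 : IsKernelOf (Abelian.image.ι α) β)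
    (hc2 : IsKernelOf (Abelian.image.ι β) γ)
    (hc3 : IsKernelOf (Abelian.image.ι γ) α)
    (hsα : IsIso (Abelian.coimageImageComparison α))
    (hsβ : IsIso (Abelian.coimageImageComparison β))
    (hsγ : IsIso (Abelian.coimageImageComparison γ))
    -- the strict factorization α = ρ ∘ σ with σ = cok γ and ρ = ker β
    (σ : D ⟶ D₁) (ρ : D₁ ⟶ D)
    (hσ : IsCokernelOf γ σ) (hρ : IsKernelOf ρ β) (hα : σ ≫ ρ = α)
    -- right construction: pushout of β along σ
    {Eσ E₁p : C} (σ'' : E ⟶ Eσ) (β'' : D₁ ⟶ Eσ) (hPO' : IsPushout β σ σ'' β'')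
    (γ'' : Eσ ⟶ D) (hγ'' : σ'' ≫ γ'' = γ) (hγ''0 : β'' ≫ γ'' = 0)
    -- right construction: pullback of γ'' along ρ
    (ρ'' : E₁p ⟶ Eσ) (γ₁p : E₁p ⟶ D₁) (hPB' : IsPullback ρ'' γ₁p γ'' ρ)
    (β₁p : D₁ ⟶ E₁p) (hβ₁p : β₁p ≫ ρ'' = β'') (hβ₁p0 : β₁p ≫ γ₁p = 0)
    :
    IsKernelOf (Abelian.image.ι (ρ ≫ σ)) β₁p ∧
    IsKernelOf (Abelian.image.ι β₁p) γ₁p ∧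
    IsKernelOf (Abelian.image.ι γ₁p) (ρ ≫ σ) := by
  have hE : ∀ {X Y : C} (f : X ⟶ Y), Epi (Abelian.factorThruImage f) :=
    fun f => semi_epi f (hsemi f).2
  have hM : ∀ {X Y : C} (f : X ⟶ Y), Mono (Abelian.factorThruCoimage f) :=
    fun f => semi_mono f (hsemi f).1
  haveI : Mono ρ := by
    obtain ⟨w, ⟨hl⟩⟩ := hρ
    exact mono_of_isLimit_fork hl
  haveI : Mono ρ'' := by
    refine ⟨fun a b hab => hPB'.hom_ext hab ?_⟩
    rw [← cancel_mono ρ, Category.assoc, Category.assoc, ← hPB'.w, ← Category.assoc, hab,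
      Category.assoc]
  have hρβ : ρ ≫ β = 0 := hρ.1
  have hγσ : γ ≫ σ = 0 := hσ.1
  have hβγ : β ≫ γ = 0 := by
    rw [← Abelian.image.fac β, Category.assoc, hc2.1, comp_zero]
  -- the cokernel of `β''` is the coimage of `γ`
  haveI := hM γ
  let t : Eσ ⟶ Abelian.coimage γ := hPO'.desc (Abelian.coimage.π γ) 0 (by
    rw [← cancel_mono (Abelian.factorThruCoimage γ), Category.assoc, Abelian.coimage.fac, hβγ]
    simp)
  have ht1 : σ'' ≫ t = Abelian.coimage.π γ := hPO'.inl_desc _ _ _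
  have ht2 : β'' ≫ t = 0 := hPO'.inr_desc _ _ _
  have htm : t ≫ Abelian.factorThruCoimage γ = γ'' := by
    apply hPO'.hom_ext
    · rw [← Category.assoc, ht1, Abelian.coimage.fac, hγ'']
    · rw [← Category.assoc, ht2, hγ''0, zero_comp]
  haveI : Epi t := epi_of_epi_fac ht1
  have htk : ∀ {W : C} (x : Eσ ⟶ W), β'' ≫ x = 0 → ∃ l, t ≫ l = x := by
    intro W x hx
    have h1 : Abelian.image.ι β ≫ σ'' ≫ x = 0 := by
      haveI := hE β
      rw [← cancel_epi (Abelian.factorThruImage β), ← Category.assoc, Abelian.image.fac,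
        ← Category.assoc, hPO'.w, Category.assoc, hx]
      simp
    have h2 : kernel.ι γ ≫ σ'' ≫ x = 0 := by
      obtain ⟨l, hl⟩ := isKernelOf_lift hc2 (kernel.ι γ) (kernel.condition γ)
      rw [← hl, Category.assoc, h1, comp_zero]
    refine ⟨cokernel.desc _ _ h2, hPO'.hom_ext ?_ ?_⟩
    · rw [← Category.assoc, ht1]
      exact cokernel.π_desc _ _ _
    · rw [← Category.assoc, ht2, hx, zero_comp]
  have hγ''σ : γ'' ≫ σ = 0 := by
    apply hPO'.hom_ext
    · rw [← Category.assoc, hγ'', hγσ, comp_zero]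
    · rw [← Category.assoc, hγ''0, zero_comp, comp_zero]
  refine ⟨?_, ?_, ?_⟩
  · -- im α₁ = ker β₁
    let π₁ := cokernel.π (ρ ≫ σ)
    have hρπ : ρ ≫ σ ≫ π₁ = 0 := by
      rw [← Category.assoc]; exact cokernel.condition _
    have hkβ : kernel.ι β ≫ σ ≫ π₁ = 0 := by
      obtain ⟨l, hl⟩ := isKernelOf_lift hρ (kernel.ι β) (kernel.condition β)
      rw [← hl, Category.assoc, hρπ, comp_zero]
    let s : Abelian.image β ⟶ cokernel (ρ ≫ σ) :=
      inv (Abelian.coimageImageComparison β) ≫ cokernel.desc _ _ hkβ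
    have hs : Abelian.factorThruImage β ≫ s = σ ≫ π₁ := by
      have : Abelian.factorThruImage β =
          Abelian.coimage.π β ≫ Abelian.coimageImageComparison β := by
        simp [Abelian.coimageImageComparison]
      rw [this]
      simp [s]
    have hρσβ : (ρ ≫ σ) ≫ β'' = 0 := by
      rw [Category.assoc, ← hPO'.w, ← Category.assoc, hρβ, zero_comp]
    let d : cokernel (ρ ≫ σ) ⟶ Eσ := cokernel.desc _ β'' hρσβ
    have hd : π₁ ≫ d = β'' := cokernel.π_desc _ _ _
    haveI : Mono d := by
      refine mono_of_pushout_kernel_s6 hE (Abelian.image.ι β) (cokernel.π β) (kernel.condition _)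
        (fun z hz => ⟨kernel.lift _ z hz, kernel.lift_ι _ _ _⟩) s d ?_
      intro T a b hab
      refine ⟨hPO'.desc a (π₁ ≫ b) ?_, ?_⟩
      · rw [← Category.assoc, ← hs, Category.assoc, ← hab, ← Category.assoc, Abelian.image.fac]
      · rw [← cancel_epi π₁, ← Category.assoc, hd, hPO'.inr_desc]
    haveI := hE (ρ ≫ σ)
    refine isKernelOf_image_s6 _ _ (Abelian.factorThruImage (ρ ≫ σ)) (Abelian.image.ι (ρ ≫ σ))
      (Abelian.image.fac _) ?_ ?_
    · rw [← cancel_epi (Abelian.factorThruImage (ρ ≫ σ)), ← Category.assoc, Abelian.image.fac,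
        ← cancel_mono ρ'', Category.assoc, hβ₁p, hρσβ]
      simp
    · intro W z hz
      have hz1 : z ≫ π₁ = 0 := by
        rw [← cancel_mono d, Category.assoc, hd, ← hβ₁p, ← Category.assoc, hz]
        simp
      exact ⟨kernel.lift _ z hz1, kernel.lift_ι _ _ _⟩
  · -- im β₁ = ker γ₁
    haveI := hE β''
    have hιγ : Abelian.image.ι β'' ≫ γ'' = 0 := by
      rw [← cancel_epi (Abelian.factorThruImage β''), ← Category.assoc, Abelian.image.fac,
        hγ''0, comp_zero]
    let k : Abelian.image β'' ⟶ E₁p := hPB'.lift (Abelian.image.ι β'') 0 (by rw [hιγ, zero_comp])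
    have hk1 : k ≫ ρ'' = Abelian.image.ι β'' := hPB'.lift_fst _ _ _
    have hk2 : k ≫ γ₁p = 0 := hPB'.lift_snd _ _ _
    refine isKernelOf_image_s6 _ _ (Abelian.factorThruImage β'') k ?_ hk2 ?_
    · rw [← cancel_mono ρ'', Category.assoc, hk1, Abelian.image.fac, hβ₁p]
    · intro W z hz
      have h1 : (z ≫ ρ'') ≫ t = 0 := by
        rw [← cancel_mono (Abelian.factorThruCoimage γ), Category.assoc, htm, Category.assoc,
          hPB'.w, ← Category.assoc, hz]
        simp
      obtain ⟨l, hl⟩ := htk (cokernel.π β'') (cokernel.condition β'')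
      have h2 : (z ≫ ρ'') ≫ cokernel.π β'' = 0 := by
        rw [← hl, ← Category.assoc, h1, zero_comp]
      refine ⟨kernel.lift _ _ h2, ?_⟩
      rw [← cancel_mono ρ'', Category.assoc, hk1]
      exact kernel.lift_ι _ _ _
  · -- im γ₁ = ker α₁
    have h0 : γ₁p ≫ ρ ≫ σ = 0 := by
      rw [← Category.assoc, ← hPB'.w, Category.assoc, hγ''σ, comp_zero]
    let e : E₁p ⟶ kernel (ρ ≫ σ) := kernel.lift _ γ₁p h0
    have he : e ≫ kernel.ι (ρ ≫ σ) = γ₁p := kernel.lift_ι _ _ _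
    have hια : (kernel.ι (ρ ≫ σ) ≫ ρ) ≫ α = 0 := by
      have := kernel.condition (ρ ≫ σ)
      rw [← hα, ← Category.assoc, Category.assoc _ ρ σ, this, zero_comp]
    obtain ⟨c, hc⟩ := isKernelOf_lift hc3 _ hια
    have hcomp : inv (Abelian.coimageImageComparison γ) ≫ Abelian.factorThruCoimage γ =
        Abelian.image.ι γ := by
      rw [IsIso.inv_comp_eq]
      ext
      simp [Abelian.coimageImageComparison]
    haveI : Epi e := by
      refine epi_of_pullback_cokernel hM t β'' ht2 htk
        (c ≫ inv (Abelian.coimageImageComparison γ)) e ?_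
      intro T a b hab
      refine ⟨hPB'.lift a (b ≫ kernel.ι (ρ ≫ σ)) ?_, ?_⟩
      · rw [← htm, ← Category.assoc, hab, Category.assoc, Category.assoc, hcomp, hc,
          Category.assoc]
      · rw [← cancel_mono (kernel.ι (ρ ≫ σ)), Category.assoc, he, hPB'.lift_snd]
    exact isKernelOf_image_s6 _ _ e (kernel.ι (ρ ≫ σ)) he (kernel.condition _)
      (fun z hz => ⟨kernel.lift _ z hz, kernel.lift_ι _ _ _⟩)
end

section
/- Let A be a semiabelian category and let α : D → D, β : D → E, γ : E → D be an exact couple in which α, β and γ are strict, and perform the left Eckmann–Hilton construction. Set ∂ = β∘γ : E → E (so ∂∘∂ = 0). Then ρ′ : E_ρ → E is a kernel of ∂, and σ′ : E_ρ → E₁⁻ is a cokernel of the canonical morphism θ : Im ∂ → E_ρ determined by ρ′∘θ = im ∂. In particular E₁⁻ is the left cohomology H⁻(E,∂) = Cok(θ : Im ∂ → Ker ∂) of the differential ∂. -/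
open CategoryTheory CategoryTheory.Limits

universe v u

variable {C : Type u} [Category.{v} C] [Preadditive C] [HasFiniteBiproducts C]
  [HasKernels C] [HasCokernels C]

/-- With ∂ = β∘γ = γ ≫ β, the morphism ρ′ of the left Eckmann–Hilton
construction is a kernel of ∂, and σ′ is a cokernel of the canonical morphism
θ : Im ∂ ⟶ E_ρ determined by ρ′∘θ = im ∂; hence E₁⁻ is the left cohomology H⁻(E,∂). -/
theorem left_derived_is_left_cohomology
    (hsemi : ∀ {X Y : C} (f : X ⟶ Y),
      Mono (Abelian.coimageImageComparison f) ∧ Epi (Abelian.coimageImageComparison f))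
    -- the exact couple, with all three morphisms strict
    {D E D₁ Eρ E₁m : C} (α : D ⟶ D) (β : D ⟶ E) (γ : E ⟶ D)
    (hc1 : IsKernelOf (Abelian.image.ι α) β)
    (hc2 : IsKernelOf (Abelian.image.ι β) γ)
    (hc3 : IsKernelOf (Abelian.image.ι γ) α)
    (hsα : IsIso (Abelian.coimageImageComparison α))
    (hsβ : IsIso (Abelian.coimageImageComparison β))
    (hsγ : IsIso (Abelian.coimageImageComparison γ))
    -- the strict factorization α = ρ ∘ σ with σ = cok γ and ρ = ker β
    (σ : D ⟶ D₁) (ρ : D₁ ⟶ D)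
    (hσ : IsCokernelOf γ σ) (hρ : IsKernelOf ρ β) (hα : σ ≫ ρ = α)
    -- left construction: pullback of γ along ρ
    (ρ' : Eρ ⟶ E) (γ' : Eρ ⟶ D₁) (hPB : IsPullback ρ' γ' γ ρ)
    (β' : D ⟶ Eρ) (hβ' : β' ≫ ρ' = β) (hβ'0 : β' ≫ γ' = 0)
    -- left construction: pushout of β' along σ
    (σ' : Eρ ⟶ E₁m) (β₁m : D₁ ⟶ E₁m) (hPO : IsPushout β' σ σ' β₁m)
    (γ₁m : E₁m ⟶ D₁) (hγ₁ : σ' ≫ γ₁m = γ') (hγ₁0 : β₁m ≫ γ₁m = 0)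
    :
    IsKernelOf ρ' (γ ≫ β) ∧
    ∀ θ : Abelian.image (γ ≫ β) ⟶ Eρ, θ ≫ ρ' = Abelian.image.ι (γ ≫ β) →
      IsCokernelOf θ σ' := by
  obtain ⟨wρ, ⟨lρ⟩⟩ := hρ
  obtain ⟨wσ, ⟨lσ⟩⟩ := hσ
  have mρ : Mono ρ := by
    constructor
    intro Z a b h
    exact Fork.IsLimit.hom_ext lρ (by simpa using h)
  have mρ' : Mono ρ' := by
    constructor
    intro Z a b h
    refine hPB.hom_ext h ?_
    rw [← cancel_mono ρ, Category.assoc, Category.assoc, ← hPB.w, reassoc_of% h]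
  refine ⟨⟨?_, ⟨?_⟩⟩, ?_⟩
  · rw [reassoc_of% hPB.w, wρ, comp_zero]
  · refine KernelFork.IsLimit.ofι' ρ' _ (fun {A} k hk => ?_)
    have h := KernelFork.IsLimit.lift' lρ (k ≫ γ) (by simpa using hk)
    exact ⟨hPB.lift k h.1 (by simpa using h.2.symm), hPB.lift_fst _ _ _⟩
  · intro θ hθ
    have hepi := (hsemi (γ ≫ β)).2
    have key : (Abelian.coimage.π (γ ≫ β) ≫ Abelian.coimageImageComparison (γ ≫ β)) ≫ θ
        = γ ≫ β' := by
      rw [← cancel_mono ρ', Category.assoc, Category.assoc, hθ, Category.assoc, hβ',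
        Abelian.coimage_image_factorisation]
    have eepi : Epi (Abelian.coimage.π (γ ≫ β) ≫ Abelian.coimageImageComparison (γ ≫ β)) :=
      epi_comp _ _
    have eσ : Epi σ := by
      constructor
      intro Z a b h
      exact Cofork.IsColimit.hom_ext lσ (by simpa using h)
    have eσ' : Epi σ' := by
      constructor
      intro Z a b h
      refine hPO.hom_ext h ?_
      rw [← cancel_epi σ, ← reassoc_of% hPO.w, ← reassoc_of% hPO.w, h]
    refine ⟨?_, ⟨?_⟩⟩
    · rw [← cancel_epi (Abelian.coimage.π (γ ≫ β) ≫ Abelian.coimageImageComparison (γ ≫ β)),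
        ← Category.assoc, key, Category.assoc, hPO.w, reassoc_of% wσ, zero_comp, comp_zero]
    · refine CokernelCofork.IsColimit.ofπ' σ' _ (fun {A} k hk => ?_)
      have h := CokernelCofork.IsColimit.desc' lσ (β' ≫ k) (by
        rw [← Category.assoc, ← key, Category.assoc, hk, comp_zero])
      exact ⟨hPO.desc k h.1 (by simpa using h.2.symm), hPO.inl_desc _ _ _⟩
end

section
/- Let A be a semiabelian category and let α : D → D, β : D → E, γ : E → D be an exact couple in which α, β and γ are strict, and perform the right Eckmann–Hilton construction. Set ∂ = β∘γ : E → E (so ∂∘∂ = 0). Then σ″ : E → E^σ is a cokernel of ∂, and ρ″ : E₁⁺ → E^σ is a kernel of the canonical morphism τ : E^σ → Coim ∂ determined by τ∘σ″ = coim ∂. In particular E₁⁺ is the right cohomology H⁺(E,∂) = Ker(τ : Cok ∂ → Coim ∂) of the differential ∂. -/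
open CategoryTheory CategoryTheory.Limits

universe v u

variable {C : Type u} [Category.{v} C] [Preadditive C] [HasFiniteBiproducts C]
  [HasKernels C] [HasCokernels C]

/-- With ∂ = β∘γ = γ ≫ β, the morphism σ″ of the right Eckmann–Hilton
construction is a cokernel of ∂, and ρ″ is a kernel of the canonical morphism
τ : E^σ ⟶ Coim ∂ determined by τ∘σ″ = coim ∂; hence E₁⁺ is the right cohomology H⁺(E,∂). -/
theorem right_derived_is_right_cohomology
    (hsemi : ∀ {X Y : C} (f : X ⟶ Y),
      Mono (Abelian.coimageImageComparison f) ∧ Epi (Abelian.coimageImageComparison f))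
    -- the exact couple, with all three morphisms strict
    {D E D₁ : C} (α : D ⟶ D) (β : D ⟶ E) (γ : E ⟶ D)
    (hc1 : IsKernelOf (Abelian.image.ι α) β)
    (hc2 : IsKernelOf (Abelian.image.ι β) γ)
    (hc3 : IsKernelOf (Abelian.image.ι γ) α)
    (hsα : IsIso (Abelian.coimageImageComparison α))
    (hsβ : IsIso (Abelian.coimageImageComparison β))
    (hsγ : IsIso (Abelian.coimageImageComparison γ))
    -- the strict factorization α = ρ ∘ σ with σ = cok γ and ρ = ker β
    (σ : D ⟶ D₁) (ρ : D₁ ⟶ D)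
    (hσ : IsCokernelOf γ σ) (hρ : IsKernelOf ρ β) (hα : σ ≫ ρ = α)
    -- right construction: pushout of β along σ
    {Eσ E₁p : C} (σ'' : E ⟶ Eσ) (β'' : D₁ ⟶ Eσ) (hPO' : IsPushout β σ σ'' β'')
    (γ'' : Eσ ⟶ D) (hγ'' : σ'' ≫ γ'' = γ) (hγ''0 : β'' ≫ γ'' = 0)
    -- right construction: pullback of γ'' along ρ
    (ρ'' : E₁p ⟶ Eσ) (γ₁p : E₁p ⟶ D₁) (hPB' : IsPullback ρ'' γ₁p γ'' ρ)
    (β₁p : D₁ ⟶ E₁p) (hβ₁p : β₁p ≫ ρ'' = β'') (hβ₁p0 : β₁p ≫ γ₁p = 0)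
    :
    IsCokernelOf (γ ≫ β) σ'' ∧
    ∀ τ : Eσ ⟶ Abelian.coimage (γ ≫ β), σ'' ≫ τ = Abelian.coimage.π (γ ≫ β) →
      IsKernelOf ρ'' τ := by
  obtain ⟨wσ, ⟨lσ⟩⟩ := hσ
  obtain ⟨wρ, ⟨lρ⟩⟩ := hρ
  have eσ : Epi σ := ⟨fun a b h => Cofork.IsColimit.hom_ext lσ h⟩
  have mρ : Mono ρ := ⟨fun a b h => Fork.IsLimit.hom_ext lρ h⟩
  have eσ'' : Epi σ'' := ⟨fun a b h => by
    apply hPO'.hom_ext h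
    rw [← cancel_epi σ, ← Category.assoc, ← Category.assoc, ← hPO'.w, Category.assoc,
      Category.assoc, h]⟩
  have mρ'' : Mono ρ'' := ⟨fun a b h => by
    apply hPB'.hom_ext h
    rw [← cancel_mono ρ, Category.assoc, Category.assoc, ← hPB'.w, ← Category.assoc,
      ← Category.assoc, h]⟩
  refine ⟨⟨by rw [Category.assoc, hPO'.w, ← Category.assoc, wσ, zero_comp], ⟨?_⟩⟩, ?_⟩
  · refine CokernelCofork.IsColimit.ofπ _ _
      (fun {T} t ht => hPO'.desc t
        (CokernelCofork.IsColimit.desc' lσ (β ≫ t) (by rw [← Category.assoc, ht])).1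
        (CokernelCofork.IsColimit.desc' lσ (β ≫ t) (by rw [← Category.assoc, ht])).2.symm)
      (fun {T} t ht => hPO'.inl_desc _ _ _)
      (fun {T} t ht m hm => ?_)
    rw [← cancel_epi σ'', hm]; exact (hPO'.inl_desc _ _ _).symm
  · intro τ hτ
    have hm := (hsemi (γ ≫ β)).1
    have key : τ ≫ Abelian.coimageImageComparison (γ ≫ β) ≫ Abelian.image.ι (γ ≫ β)
        = γ'' ≫ β := by
      rw [← cancel_epi σ'', ← Category.assoc, hτ, Abelian.coimage_image_factorisation,
        ← Category.assoc, hγ'']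
    have wτ : ρ'' ≫ τ = 0 := by
      rw [← cancel_mono (Abelian.coimageImageComparison (γ ≫ β) ≫ Abelian.image.ι (γ ≫ β)),
        Category.assoc, key, ← Category.assoc, hPB'.w, Category.assoc, wρ, comp_zero, zero_comp]
    refine ⟨wτ, ⟨?_⟩⟩
    have hk : ∀ {T : C} (t : T ⟶ Eσ), t ≫ τ = 0 → (t ≫ γ'') ≫ β = 0 := by
      intro T t ht
      rw [Category.assoc, ← key, ← Category.assoc, ht, zero_comp]
    refine KernelFork.IsLimit.ofι _ _
      (fun {T} t ht => hPB'.lift t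
        (KernelFork.IsLimit.lift' lρ (t ≫ γ'') (hk t ht)).1
        (KernelFork.IsLimit.lift' lρ (t ≫ γ'') (hk t ht)).2.symm)
      (fun {T} t ht => hPB'.lift_fst _ _ _)
      (fun {T} t ht m hm => ?_)
    rw [← cancel_mono ρ'', hm]; exact (hPB'.lift_fst _ _ _).symm
end

section
/- Let A be a semiabelian category and let α : D → D, β : D → E, γ : E → D be an exact couple in which α, β and γ are strict, and perform both the left and the right Eckmann–Hilton constructions. Set ∂ = β∘γ : E → E and let ω : E₁⁻ → E₁⁺ be the unique morphism with ρ″∘ω∘σ′ = σ″∘ρ′. If ker ∂ is a semistable kernel or cok ∂ is a semistable cokernel, then ω is an isomorphism. -/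
open CategoryTheory CategoryTheory.Limits

universe v u

variable {C : Type u} [Category.{v} C] [Preadditive C] [HasFiniteBiproducts C]
  [HasKernels C] [HasCokernels C]

/-- If ker ∂ is a semistable kernel or cok ∂ is a semistable cokernel
(∂ = β∘γ = γ ≫ β), then the canonical morphism ω : E₁⁻ ⟶ E₁⁺ with ρ″∘ω∘σ′ = σ″∘ρ′
is an isomorphism. -/
theorem canonical_bimorphism_isIso_of_semistable
    (hsemi : ∀ {X Y : C} (f : X ⟶ Y),
      Mono (Abelian.coimageImageComparison f) ∧ Epi (Abelian.coimageImageComparison f))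
    -- the exact couple, with all three morphisms strict
    {D E D₁ Eρ E₁m : C} (α : D ⟶ D) (β : D ⟶ E) (γ : E ⟶ D)
    (hc1 : IsKernelOf (Abelian.image.ι α) β)
    (hc2 : IsKernelOf (Abelian.image.ι β) γ)
    (hc3 : IsKernelOf (Abelian.image.ι γ) α)
    (hsα : IsIso (Abelian.coimageImageComparison α))
    (hsβ : IsIso (Abelian.coimageImageComparison β))
    (hsγ : IsIso (Abelian.coimageImageComparison γ))
    -- the strict factorization α = ρ ∘ σ with σ = cok γ and ρ = ker β
    (σ : D ⟶ D₁) (ρ : D₁ ⟶ D)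
    (hσ : IsCokernelOf γ σ) (hρ : IsKernelOf ρ β) (hα : σ ≫ ρ = α)
    -- left construction: pullback of γ along ρ
    (ρ' : Eρ ⟶ E) (γ' : Eρ ⟶ D₁) (hPB : IsPullback ρ' γ' γ ρ)
    (β' : D ⟶ Eρ) (hβ' : β' ≫ ρ' = β) (hβ'0 : β' ≫ γ' = 0)
    -- left construction: pushout of β' along σ
    (σ' : Eρ ⟶ E₁m) (β₁m : D₁ ⟶ E₁m) (hPO : IsPushout β' σ σ' β₁m)
    (γ₁m : E₁m ⟶ D₁) (hγ₁ : σ' ≫ γ₁m = γ') (hγ₁0 : β₁m ≫ γ₁m = 0)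
    -- right construction: pushout of β along σ
    {Eσ E₁p : C} (σ'' : E ⟶ Eσ) (β'' : D₁ ⟶ Eσ) (hPO' : IsPushout β σ σ'' β'')
    (γ'' : Eσ ⟶ D) (hγ'' : σ'' ≫ γ'' = γ) (hγ''0 : β'' ≫ γ'' = 0)
    -- right construction: pullback of γ'' along ρ
    (ρ'' : E₁p ⟶ Eσ) (γ₁p : E₁p ⟶ D₁) (hPB' : IsPullback ρ'' γ₁p γ'' ρ)
    (β₁p : D₁ ⟶ E₁p) (hβ₁p : β₁p ≫ ρ'' = β'') (hβ₁p0 : β₁p ≫ γ₁p = 0)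
    (ω : E₁m ⟶ E₁p) (hω : σ' ≫ ω ≫ ρ'' = ρ' ≫ σ'')
    (hsem : SemistableKernel (kernel.ι (γ ≫ β)) ∨ SemistableCokernel (cokernel.π (γ ≫ β)))
    :
    IsIso ω := by
  obtain ⟨wσ, ⟨lσ⟩⟩ := hσ
  obtain ⟨wρ, ⟨lρ⟩⟩ := hρ
  have epiσ : Epi σ := Cofork.IsColimit.epi lσ
  have monoρ : Mono ρ := Fork.IsLimit.mono lρ
  have epiσ'' : Epi σ'' := ⟨fun a b h => hPO'.hom_ext h (by
    rw [← cancel_epi σ, ← Category.assoc, ← Category.assoc, ← hPO'.w, Category.assoc,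
      Category.assoc, h])⟩
  have epiσ' : Epi σ' := ⟨fun a b h => hPO.hom_ext h (by
    rw [← cancel_epi σ, ← Category.assoc, ← Category.assoc, ← hPO.w, Category.assoc,
      Category.assoc, h])⟩
  have monoρ' : Mono ρ' := ⟨fun a b h => hPB.hom_ext h (by
    rw [← cancel_mono ρ, Category.assoc, Category.assoc, ← hPB.w, reassoc_of% h])⟩
  have monoρ'' : Mono ρ'' := ⟨fun a b h => hPB'.hom_ext h (by
    rw [← cancel_mono ρ, Category.assoc, Category.assoc, ← hPB'.w, reassoc_of% h])⟩
  have hy : β₁m ≫ ω ≫ ρ'' = β'' := by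
    rw [← cancel_epi σ, ← hPO'.w, ← hβ', Category.assoc, ← hω, ← Category.assoc, ← hPO.w,
      Category.assoc]
  have hx : (σ' ≫ ω) ≫ γ₁p = γ' := by
    rw [← cancel_mono ρ, ← hPB.w, ← hγ'', Category.assoc, Category.assoc, ← hPB'.w,
      ← Category.assoc ρ', ← hω]
    simp
  have sqO : IsPushout ρ' σ' σ'' (ω ≫ ρ'') := by
    refine IsPushout.of_left (h₁₁ := β') (v₁₁ := σ) (h₂₁ := β₁m) ?_ hω.symm hPO
    rw [hβ', hy]; exact hPO'
  have sqB : IsPullback ρ' (σ' ≫ ω) σ'' ρ'' := by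
    refine (IsPullback.of_right (h₁₁ := σ' ≫ ω) (h₁₂ := γ₁p) (h₂₁ := σ'') (h₂₂ := γ'')
      (v₁₃ := ρ) ?_ (by simpa using hω) hPB'.flip).flip
    rw [hx, hγ'']; exact hPB.flip
  have mono_m := (hsemi (γ ≫ β)).1
  have epi_m := (hsemi (γ ≫ β)).2
  have fac := Abelian.coimage_image_factorisation (γ ≫ β)
  have hkerd : ρ' ≫ γ ≫ β = 0 := by rw [hPB.w_assoc, wρ, comp_zero]
  have hcokd : (γ ≫ β) ≫ σ'' = 0 := by
    rw [Category.assoc, hPO'.w, ← Category.assoc, wσ, zero_comp]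
  rcases hsem with ⟨-, hs⟩ | ⟨-, hs⟩
  · -- the case of a semistable kernel
    let j : kernel (γ ≫ β) ⟶ Eρ := hPB.lift (kernel.ι (γ ≫ β))
      (lρ.lift (KernelFork.ofι (kernel.ι (γ ≫ β) ≫ γ) (by simp)))
      (lρ.fac (KernelFork.ofι (kernel.ι (γ ≫ β) ≫ γ) (by simp)) WalkingParallelPair.zero).symm
    have hj : j ≫ ρ' = kernel.ι (γ ≫ β) := hPB.lift_fst _ _ _
    let e : kernel (γ ≫ β) ≅ Eρ :=
      { hom := j
        inv := kernel.lift _ ρ' hkerd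
        hom_inv_id := by rw [← cancel_mono (kernel.ι (γ ≫ β))]; simp [hj]
        inv_hom_id := by rw [← cancel_mono ρ']; simp [hj] }
    have sq : IsPushout (kernel.ι (γ ≫ β)) (j ≫ σ') σ'' (ω ≫ ρ'') :=
      IsPushout.of_iso sqO e.symm (Iso.refl _) (Iso.refl _) (Iso.refl _)
        (by simp [e]) ((Category.comp_id _).trans (e.inv_hom_id_assoc σ').symm) (by simp) (by simp)
    obtain ⟨Z, h, wh, ⟨lh⟩⟩ := hs _ _ _ sq
    have monoy : Mono (ω ≫ ρ'') := Fork.IsLimit.mono lh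
    have hρ'π : ρ' ≫ Abelian.coimage.π (γ ≫ β) = 0 := by
      have : IsIso j := e.isIso_hom
      rw [← cancel_epi j, ← Category.assoc, hj, comp_zero]; exact cokernel.condition _
    let q : Eσ ⟶ Abelian.coimage (γ ≫ β) :=
      sqO.desc (Abelian.coimage.π (γ ≫ β)) 0 (by rw [hρ'π, comp_zero])
    have hq : σ'' ≫ q = Abelian.coimage.π (γ ≫ β) := sqO.inl_desc _ _ _
    have hqm : q ≫ Abelian.coimageImageComparison (γ ≫ β) ≫ Abelian.image.ι (γ ≫ β)
        = γ'' ≫ β := by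
      rw [← cancel_epi σ'', reassoc_of% hq, reassoc_of% hγ'']; exact fac
    have hρq : ρ'' ≫ q = 0 := by
      rw [← cancel_mono (Abelian.coimageImageComparison (γ ≫ β)),
        ← cancel_mono (Abelian.image.ι (γ ≫ β)), Category.assoc, Category.assoc, hqm,
        hPB'.w_assoc, wρ]
      simp
    have h0 : kernel.ι (γ ≫ β) ≫ σ'' ≫ h = 0 := by
      rw [← hj, Category.assoc, sqO.w_assoc, wh]; simp
    have hh : q ≫ cokernel.desc (kernel.ι (γ ≫ β)) (σ'' ≫ h) h0 = h := by
      rw [← cancel_epi σ'', reassoc_of% hq]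
      exact cokernel.π_desc _ _ _
    have hρh : ρ'' ≫ h = 0 := by rw [← hh, reassoc_of% hρq, zero_comp]
    let l : E₁p ⟶ E₁m := lh.lift (KernelFork.ofι ρ'' hρh)
    have hl : l ≫ ω ≫ ρ'' = ρ'' := lh.fac (KernelFork.ofι ρ'' hρh) WalkingParallelPair.zero
    refine ⟨l, ?_, ?_⟩
    · rw [← cancel_mono (ω ≫ ρ''), Category.assoc, hl, Category.id_comp]
    · rw [← cancel_mono ρ'', Category.assoc, hl, Category.id_comp]
  · -- the case of a semistable cokernel
    let j : Eσ ⟶ cokernel (γ ≫ β) := hPO'.desc (cokernel.π (γ ≫ β))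
      (lσ.desc (CokernelCofork.ofπ (β ≫ cokernel.π (γ ≫ β)) (by
        rw [← Category.assoc, cokernel.condition])))
      (lσ.fac (CokernelCofork.ofπ (β ≫ cokernel.π (γ ≫ β)) (by
        rw [← Category.assoc, cokernel.condition])) WalkingParallelPair.one).symm
    have hj : σ'' ≫ j = cokernel.π (γ ≫ β) := hPO'.inl_desc _ _ _
    let e : Eσ ≅ cokernel (γ ≫ β) :=
      { hom := j
        inv := cokernel.desc _ σ'' hcokd
        hom_inv_id := by rw [← cancel_epi σ'', reassoc_of% hj]; simp
        inv_hom_id := by rw [← cancel_epi (cokernel.π (γ ≫ β))]; simp [hj] }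
    have sq : IsPullback ρ' (σ' ≫ ω) (cokernel.π (γ ≫ β)) (ρ'' ≫ j) :=
      IsPullback.of_iso sqB (Iso.refl _) (Iso.refl _) (Iso.refl _) e
        (by simp) (by simp) (by simp [e, hj]) (by simp [e])
    obtain ⟨W, h, wh, ⟨lh⟩⟩ := hs _ _ _ sq
    have epix : Epi (σ' ≫ ω) := Cofork.IsColimit.epi lh
    have hισ : Abelian.image.ι (γ ≫ β) ≫ σ'' = 0 := by
      have : IsIso j := e.isIso_hom
      rw [← cancel_mono j, Category.assoc, hj, zero_comp]; exact kernel.condition _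
    let k : Abelian.image (γ ≫ β) ⟶ Eρ :=
      sqB.lift (Abelian.image.ι (γ ≫ β)) 0 (by rw [hισ, zero_comp])
    have hk : k ≫ ρ' = Abelian.image.ι (γ ≫ β) := sqB.lift_fst _ _ _
    have hmk : (Abelian.coimage.π (γ ≫ β) ≫ Abelian.coimageImageComparison (γ ≫ β)) ≫ k
        = γ ≫ β' := by
      rw [← cancel_mono ρ', Category.assoc, Category.assoc, Category.assoc, hk, hβ']; exact fac
    have hkσ : k ≫ σ' = 0 := by
      rw [← cancel_epi (Abelian.coimageImageComparison (γ ≫ β)),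
        ← cancel_epi (Abelian.coimage.π (γ ≫ β))]
      have := congrArg (· ≫ σ') hmk
      simp only [Category.assoc, hPO.w, reassoc_of% wσ, zero_comp] at this
      rw [this]; simp
    have h0 : (h ≫ ρ') ≫ cokernel.π (γ ≫ β) = 0 := by
      rw [← hj, Category.assoc, sqB.w_assoc, Category.assoc, reassoc_of% wh]; simp
    have hh : kernel.lift (cokernel.π (γ ≫ β)) (h ≫ ρ') h0 ≫ k = h := by
      rw [← cancel_mono ρ', Category.assoc, hk]
      exact kernel.lift_ι _ _ _
    have hhσ : h ≫ σ' = 0 := by rw [← hh, Category.assoc, hkσ, comp_zero]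
    let l : E₁p ⟶ E₁m := lh.desc (CokernelCofork.ofπ σ' hhσ)
    have hl : (σ' ≫ ω) ≫ l = σ' := lh.fac (CokernelCofork.ofπ σ' hhσ) WalkingParallelPair.one
    refine ⟨l, ?_, ?_⟩
    · rw [← cancel_epi σ', ← Category.assoc, hl, Category.comp_id]
    · rw [← cancel_epi (σ' ≫ ω), ← Category.assoc, hl, Category.comp_id]
end

section
/- Let A be a semiabelian category and let α : D → D, β : D → E, γ : E → D be an exact couple such that β and γ are strict, the kernel im β = ker γ is a semistable kernel, the cokernel cok β = coim γ is a semistable cokernel, and the powers α^k are strict for all 1 ≤ k ≤ n (n ≥ 1). Perform the left and right Eckmann–Hilton constructions. Then in both derived couples: β₁⁻, γ₁⁻, β₁⁺ and γ₁⁺ are strict; im β₁⁻ = ker γ₁⁻ and im β₁⁺ = ker γ₁⁺ are semistable kernels; cok β₁⁻ = coim γ₁⁻ and cok β₁⁺ = coim γ₁⁺ are semistable cokernels; and the powers α₁^k of α₁ = σ∘ρ are strict for all 1 ≤ k ≤ n−1. (Hence the derivation process can be iterated n times.) -/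
open CategoryTheory CategoryTheory.Limits

universe v u

variable {C : Type u} [Category.{v} C] [Preadditive C] [HasFiniteBiproducts C]
  [HasKernels C] [HasCokernels C]

/-- The `k`-th power `f^k` of an endomorphism `f : X ⟶ X`. -/
def iterComp {X : C} (f : X ⟶ X) : ℕ → (X ⟶ X)
  | 0 => 𝟙 X
  | (k + 1) => iterComp f k ≫ f

set_option linter.unusedSectionVars false

/-- The semiabelian condition. -/
def SemiAb (C : Type u) [Category.{v} C] [Preadditive C] [HasFiniteBiproducts C]
    [HasKernels C] [HasCokernels C] : Prop := ∀ ⦃X Y : C⦄ (f : X ⟶ Y),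
      Mono (Abelian.coimageImageComparison f) ∧ Epi (Abelian.coimageImageComparison f)

theorem isKernelOf_iff {X Y Z : C} (i : X ⟶ Y) (g : Y ⟶ Z) :
    IsKernelOf i g ↔ i ≫ g = 0 ∧ Mono i ∧
      ∀ ⦃W : C⦄ (t : W ⟶ Y), t ≫ g = 0 → ∃ l, l ≫ i = t := by
  constructor
  · rintro ⟨w, ⟨h⟩⟩
    refine ⟨w, ⟨fun a b hab => Fork.IsLimit.hom_ext h hab⟩, fun W t ht => ?_⟩
    obtain ⟨l, hl⟩ := KernelFork.IsLimit.lift' h t ht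
    exact ⟨l, hl⟩
  · rintro ⟨w, hm, h⟩
    exact ⟨w, ⟨KernelFork.IsLimit.ofι' i w fun t ht => ⟨(h t ht).choose, (h t ht).choose_spec⟩⟩⟩

theorem isCokernelOf_iff {X Y Q : C} (g : X ⟶ Y) (p : Y ⟶ Q) :
    IsCokernelOf g p ↔ g ≫ p = 0 ∧ Epi p ∧
      ∀ ⦃W : C⦄ (t : Y ⟶ W), g ≫ t = 0 → ∃ l, p ≫ l = t := by
  constructor
  · rintro ⟨w, ⟨h⟩⟩
    refine ⟨w, ⟨fun a b hab => Cofork.IsColimit.hom_ext h hab⟩, fun W t ht => ?_⟩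
    obtain ⟨l, hl⟩ := CokernelCofork.IsColimit.desc' h t ht
    exact ⟨l, hl⟩
  · rintro ⟨w, hm, h⟩
    exact ⟨w, ⟨CokernelCofork.IsColimit.ofπ' p w
      fun t ht => ⟨(h t ht).choose, (h t ht).choose_spec⟩⟩⟩

theorem isKernelOf_kernel {X Y : C} (f : X ⟶ Y) : IsKernelOf (kernel.ι f) f :=
  (isKernelOf_iff _ _).2 ⟨kernel.condition f, inferInstance,
    fun _ t ht => ⟨kernel.lift f t ht, kernel.lift_ι _ _ _⟩⟩

theorem isCokernelOf_cokernel {X Y : C} (f : X ⟶ Y) : IsCokernelOf f (cokernel.π f) :=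
  (isCokernelOf_iff _ _).2 ⟨cokernel.condition f, inferInstance,
    fun _ t ht => ⟨cokernel.desc f t ht, cokernel.π_desc _ _ _⟩⟩

theorem IsAKernel.strong {X Y : C} {f : X ⟶ Y} (h : IsAKernel f) : StrongMono f := by
  obtain ⟨Z, g, w, ⟨hl⟩⟩ := h
  have : NormalMono f := ⟨Z, g, w, hl⟩
  infer_instance

theorem IsACokernel.strong {X Y : C} {f : X ⟶ Y} (h : IsACokernel f) : StrongEpi f := by
  obtain ⟨Z, g, w, ⟨hl⟩⟩ := h
  have : NormalEpi f := ⟨Z, g, w, hl⟩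
  infer_instance

theorem strongMono_kernel {X Y : C} (f : X ⟶ Y) : StrongMono (kernel.ι f) :=
  IsAKernel.strong ⟨_, _, isKernelOf_kernel f⟩

theorem strongEpi_cokernel {X Y : C} (f : X ⟶ Y) : StrongEpi (cokernel.π f) :=
  IsACokernel.strong ⟨_, _, isCokernelOf_cokernel f⟩

theorem strongMono_left {X Y Z : C} {f : X ⟶ Y} {g : Y ⟶ Z} {h : X ⟶ Z} (e : f ≫ g = h)
    (hh : StrongMono h) : StrongMono f := by
  subst e; exact strongMono_of_strongMono f g

theorem strongEpi_right {X Y Z : C} {f : X ⟶ Y} {g : Y ⟶ Z} {h : X ⟶ Z} (e : f ≫ g = h)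
    (hh : StrongEpi h) : StrongEpi g := by
  subst e; exact strongEpi_of_strongEpi f g

/-- In a semiabelian category a strong mono is the kernel of its cokernel. -/
theorem CategoryTheory.StrongMono.isKernelOf_coker (hs : SemiAb C) {X Y Q : C} {f : X ⟶ Y} (hf : StrongMono f)
    {p : Y ⟶ Q} (hp : IsCokernelOf f p) : IsKernelOf f p := by
  rw [isCokernelOf_iff] at hp
  obtain ⟨hp0, hp1, hp2⟩ := hp
  have hfac := Abelian.coimage_image_factorisation f
  have := (hs f).2
  have : StrongMono (Abelian.coimage.π f ≫ Abelian.coimageImageComparison f) :=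
    strongMono_left (g := Abelian.image.ι f) (by rw [Category.assoc, hfac]) hf
  have := isIso_of_epi_of_strongMono
    (Abelian.coimage.π f ≫ Abelian.coimageImageComparison f)
  rw [isKernelOf_iff]
  refine ⟨hp0, inferInstance, fun W t ht => ?_⟩
  obtain ⟨l, hl⟩ := hp2 (cokernel.π f) (cokernel.condition f)
  have h0 : t ≫ cokernel.π f = 0 := by rw [← hl, reassoc_of% ht, zero_comp]
  refine ⟨kernel.lift _ t h0 ≫
    inv (Abelian.coimage.π f ≫ Abelian.coimageImageComparison f), ?_⟩
  have : inv (Abelian.coimage.π f ≫ Abelian.coimageImageComparison f) ≫ f =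
      Abelian.image.ι f := by
    rw [IsIso.inv_comp_eq, Category.assoc, hfac]
  rw [Category.assoc, this]
  exact kernel.lift_ι _ _ _

theorem CategoryTheory.StrongEpi.isCokernelOf_ker (hs : SemiAb C) {K X Y : C} {f : X ⟶ Y} (hf : StrongEpi f)
    {i : K ⟶ X} (hi : IsKernelOf i f) : IsCokernelOf i f := by
  rw [isKernelOf_iff] at hi
  obtain ⟨hp0, hp1, hp2⟩ := hi
  have hfac := Abelian.coimage_image_factorisation f
  have := (hs f).1
  have : StrongEpi (Abelian.coimageImageComparison f ≫ Abelian.image.ι f) :=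
    strongEpi_right (f := Abelian.coimage.π f) hfac hf
  have := isIso_of_mono_of_strongEpi
    (Abelian.coimageImageComparison f ≫ Abelian.image.ι f)
  rw [isCokernelOf_iff]
  refine ⟨hp0, inferInstance, fun W t ht => ?_⟩
  obtain ⟨l, hl⟩ := hp2 (kernel.ι f) (kernel.condition f)
  have h0 : kernel.ι f ≫ t = 0 := by rw [← hl, Category.assoc, ht, comp_zero]
  refine ⟨inv (Abelian.coimageImageComparison f ≫ Abelian.image.ι f) ≫
    cokernel.desc _ t h0, ?_⟩
  have : f ≫ inv (Abelian.coimageImageComparison f ≫ Abelian.image.ι f) =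
      Abelian.coimage.π f := by
    rw [IsIso.comp_inv_eq, hfac]
  rw [reassoc_of% this]
  exact cokernel.π_desc _ _ _

theorem CategoryTheory.StrongMono.isAKernel (hs : SemiAb C) {X Y : C} {f : X ⟶ Y} (hf : StrongMono f) :
    IsAKernel f := ⟨_, _, hf.isKernelOf_coker hs (isCokernelOf_cokernel f)⟩

theorem CategoryTheory.StrongEpi.isACokernel (hs : SemiAb C) {X Y : C} {f : X ⟶ Y} (hf : StrongEpi f) :
    IsACokernel f := ⟨_, _, hf.isCokernelOf_ker hs (isKernelOf_kernel f)⟩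

theorem strongMono_pullback {P X Y Z : C} {a : P ⟶ X} {b : P ⟶ Y} {f : X ⟶ Z} {g : Y ⟶ Z}
    (h : IsPullback a b f g) (hf : StrongMono f) : StrongMono b where
  mono := ⟨fun u w huw => h.hom_ext (by
    rw [← cancel_mono f, Category.assoc, Category.assoc, h.w, reassoc_of% huw]) huw⟩
  rlp _ _ z _ := h.hasLiftingProperty z

theorem strongEpi_pushout {P X Y Z : C} {f : Z ⟶ X} {g : Z ⟶ Y} {a : X ⟶ P} {b : Y ⟶ P}
    (h : IsPushout f g a b) (hf : StrongEpi f) : StrongEpi b where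
  epi := ⟨fun u w huw => h.hom_ext (by
    rw [← cancel_epi f, reassoc_of% h.w, reassoc_of% h.w, huw]) huw⟩
  llp _ _ z _ := h.flip.hasLiftingProperty z

theorem hasPushouts' : HasPushouts C := by
  have : HasCoequalizers C := Preadditive.hasCoequalizers_of_hasCokernels
  exact hasPushouts_of_hasBinaryCoproducts_of_hasCoequalizers C

theorem hasPullbacks' : HasPullbacks C := by
  have : HasEqualizers C := Preadditive.hasEqualizers_of_hasKernels
  exact hasPullbacks_of_hasBinaryProducts_of_hasEqualizers C

theorem SemistableKernel.left (hs : SemiAb C) {X Y Z : C} {f : X ⟶ Y} {g : Y ⟶ Z} {h : X ⟶ Z}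
    (e : f ≫ g = h) (hh : SemistableKernel h) : SemistableKernel f := by
  subst e
  refine ⟨(strongMono_left rfl hh.1.strong).isAKernel hs, fun s t y hp => ?_⟩
  have : HasPushouts C := hasPushouts'
  have h2 := IsPushout.of_hasPushout g t
  have h3 := hp.paste_horiz h2
  exact (strongMono_left rfl (hh.2 _ _ _ h3).strong).isAKernel hs

theorem SemistableCokernel.right (hs : SemiAb C) {X Y Z : C} {f : X ⟶ Y} {g : Y ⟶ Z} {h : X ⟶ Z}
    (e : f ≫ g = h) (hh : SemistableCokernel h) : SemistableCokernel g := by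
  subst e
  refine ⟨(strongEpi_right rfl hh.1.strong).isACokernel hs, fun t y s hp => ?_⟩
  have : HasPullbacks C := hasPullbacks'
  have h2 := IsPullback.of_hasPullback f t
  have h3 := h2.flip.paste_horiz hp.flip
  exact (strongEpi_right rfl (hh.2 _ _ _ h3.flip).strong).isACokernel hs

theorem SemistableKernel.pushout {X Y Z P : C} {f : X ⟶ Y} (hf : SemistableKernel f)
    {s : X ⟶ Z} {t : Y ⟶ P} {y : Z ⟶ P} (h : IsPushout f s t y) : SemistableKernel y :=
  ⟨hf.2 _ _ _ h, fun _ _ _ h' => hf.2 _ _ _ (h.paste_vert h')⟩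

theorem SemistableCokernel.pullback {P Y Z Q : C} {f : Y ⟶ Q} (hf : SemistableCokernel f)
    {t : P ⟶ Y} {y : P ⟶ Z} {s : Z ⟶ Q} (h : IsPullback t y f s) : SemistableCokernel y :=
  ⟨hf.2 _ _ _ h, fun _ _ _ h' => hf.2 _ _ _ (h'.paste_horiz h)⟩

/-- Semistable short exact sequences. -/
structure SES {K E Q : C} (i : K ⟶ E) (p : E ⟶ Q) : Prop where
  ker : IsKernelOf i p
  cok : IsCokernelOf i p
  ssk : SemistableKernel i
  ssc : SemistableCokernel p

theorem SES.pullback (hs : SemiAb C) {K E Q E' Q' : C} {i : K ⟶ E} {p : E ⟶ Q} (h : SES i p)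
    {r : E' ⟶ E} {p' : E' ⟶ Q'} {k : Q' ⟶ Q} (hp : IsPullback r p' p k) :
    ∃ i' : K ⟶ E', i' ≫ r = i ∧ SES i' p' := by
  obtain ⟨h0, h1, h2⟩ := (isKernelOf_iff _ _).1 h.ker
  have hi1 : hp.lift i 0 (by simp [h0]) ≫ r = i := hp.lift_fst _ _ _
  have hi2 : hp.lift i 0 (by simp [h0]) ≫ p' = 0 := hp.lift_snd _ _ _
  generalize hp.lift i 0 (by simp [h0]) = i' at hi1 hi2
  have hk : IsKernelOf i' p' := by
    rw [isKernelOf_iff]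
    refine ⟨hi2, (h.ssk.left hs hi1).1.strong.mono, fun W t ht => ?_⟩
    obtain ⟨l, hl⟩ := h2 (t ≫ r) (by rw [Category.assoc, hp.w, reassoc_of% ht, zero_comp])
    exact ⟨l, hp.hom_ext (by rw [Category.assoc, hi1, hl])
      (by rw [Category.assoc, hi2, comp_zero, ht])⟩
  have hc := h.ssc.pullback hp
  exact ⟨i', hi1, hk, hc.1.strong.isCokernelOf_ker hs hk, h.ssk.left hs hi1, hc⟩

theorem SES.pushout (hs : SemiAb C) {K E Q K' E' : C} {i : K ⟶ E} {p : E ⟶ Q} (h : SES i p)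
    {s : K ⟶ K'} {t : E ⟶ E'} {i' : K' ⟶ E'} (hp : IsPushout i s t i') :
    ∃ p' : E' ⟶ Q, t ≫ p' = p ∧ SES i' p' := by
  obtain ⟨h0, h1, h2⟩ := (isCokernelOf_iff _ _).1 h.cok
  have hi1 : t ≫ hp.desc p 0 (by simp [h0]) = p := hp.inl_desc _ _ _
  have hi2 : i' ≫ hp.desc p 0 (by simp [h0]) = 0 := hp.inr_desc _ _ _
  generalize hp.desc p 0 (by simp [h0]) = p' at hi1 hi2
  have hk : IsCokernelOf i' p' := by
    rw [isCokernelOf_iff]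
    refine ⟨hi2, (h.ssc.right hs hi1).1.strong.epi, fun W u hu => ?_⟩
    obtain ⟨l, hl⟩ := h2 (t ≫ u) (by rw [reassoc_of% hp.w, hu, comp_zero])
    exact ⟨l, hp.hom_ext (by rw [reassoc_of% hi1, hl])
      (by rw [reassoc_of% hi2, zero_comp, hu])⟩
  have hc := h.ssk.pushout hp
  exact ⟨p', hi1, hc.1.strong.isKernelOf_coker hs hk, hk, hc, h.ssc.right hs hi1⟩

/-- If `a ≫ f ≫ b` is a strong epi followed by a strong mono, with `a` strong epi, `b` strong
mono, then `f` is strict. -/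
theorem strict_of_comp (hs : SemiAb C) {A X Y B M : C} {a : A ⟶ X} {f : X ⟶ Y} {b : Y ⟶ B}
    (ha : StrongEpi a) (hb : StrongMono b) {e : A ⟶ M} {m : M ⟶ B} (he : StrongEpi e)
    (hm : StrongMono m) (h : a ≫ f ≫ b = e ≫ m) :
    IsIso (Abelian.coimageImageComparison f) := by
  have hfac := Abelian.coimage_image_factorisation f
  have := (hs f).1
  have := (hs f).2
  have : StrongEpi (Abelian.coimage.π f) := strongEpi_cokernel _
  have : StrongMono (Abelian.image.ι f) := strongMono_kernel _
  have sq : CommSq e (a ≫ Abelian.coimage.π f) m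
      (Abelian.coimageImageComparison f ≫ Abelian.image.ι f ≫ b) := ⟨by
    rw [← h]
    conv_lhs => rw [← hfac]
    simp only [Category.assoc]⟩
  have h1 := sq.fac_left
  have h2 := sq.fac_right
  generalize sq.lift = l at h1 h2
  have : StrongEpi l := strongEpi_right h1 he
  have : Mono (l ≫ m) := by rw [h2]; infer_instance
  have : Mono l := mono_of_mono l m
  have := isIso_of_mono_of_strongEpi l
  have : StrongMono (Abelian.coimageImageComparison f) :=
    strongMono_left h2.symm inferInstance
  exact isIso_of_epi_of_strongMono _

theorem strict_fac {X Y : C} (f : X ⟶ Y) (h : IsIso (Abelian.coimageImageComparison f)) :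
    ∃ (M : C) (e : X ⟶ M) (m : M ⟶ Y), StrongEpi e ∧ StrongMono m ∧ e ≫ m = f := by
  have : StrongEpi (Abelian.coimage.π f) := strongEpi_cokernel _
  have : StrongMono (Abelian.image.ι f) := strongMono_kernel _
  exact ⟨_, Abelian.coimage.π f, Abelian.coimageImageComparison f ≫ Abelian.image.ι f,
    inferInstance, inferInstance, Abelian.coimage_image_factorisation f⟩

theorem final_step (hs : SemiAb C) {D K E Q : C} {q : D ⟶ K} {i : K ⟶ E} {p : E ⟶ Q} {j : Q ⟶ D}
    (hq : StrongEpi q) (hj : StrongMono j) (h : SES i p) {β : D ⟶ E} {γ : E ⟶ D}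
    (hβ : q ≫ i = β) (hγ : p ≫ j = γ) :
    IsIso (Abelian.coimageImageComparison β) ∧ IsIso (Abelian.coimageImageComparison γ) ∧
    IsKernelOf (Abelian.image.ι β) γ ∧ SemistableKernel (Abelian.image.ι β) ∧
    IsCokernelOf (kernel.ι γ) (cokernel.π β) ∧ SemistableCokernel (cokernel.π β) := by
  have hi := h.ssk.1.strong
  have hp := h.ssc.1.strong
  obtain ⟨k0, k1, k2⟩ := (isKernelOf_iff _ _).1 h.ker
  obtain ⟨c0, c1, c2⟩ := (isCokernelOf_iff _ _).1 h.cok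
  have hβp : β ≫ p = 0 := by rw [← hβ, Category.assoc, k0, comp_zero]
  have hic : i ≫ cokernel.π β = 0 := by
    rw [← cancel_epi q, reassoc_of% hβ, cokernel.condition, comp_zero]
  have hιp : Abelian.image.ι β ≫ p = 0 := by
    rw [← cokernel.π_desc β p hβp, kernel.condition_assoc, zero_comp]
  obtain ⟨b, hb⟩ := k2 _ hιp
  obtain ⟨d, hd⟩ := c2 _ hic
  -- isomorphisms `K ≅ Im β` and `Q ≅ Cok β`
  have ha : kernel.lift _ i hic ≫ Abelian.image.ι β = i := kernel.lift_ι _ _ _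
  generalize kernel.lift _ i hic = a at ha
  have hc : cokernel.π β ≫ cokernel.desc β p hβp = p := cokernel.π_desc _ _ _
  generalize cokernel.desc β p hβp = c at hc
  have hβγ : Abelian.image.ι β ≫ γ = 0 := by rw [← hγ, reassoc_of% hιp, zero_comp]
  have hab : a ≫ b = 𝟙 _ := by rw [← cancel_mono i, Category.assoc, hb, ha, Category.id_comp]
  have hba : b ≫ a = 𝟙 _ := by
    rw [← cancel_mono (Abelian.image.ι β), Category.assoc, ha, hb, Category.id_comp]
  have hcd : c ≫ d = 𝟙 _ := by
    rw [← cancel_epi (cokernel.π β), reassoc_of% hc, hd, Category.comp_id]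
  have hdc : d ≫ c = 𝟙 _ := by rw [← cancel_epi p, reassoc_of% hd, hc, Category.comp_id]
  refine ⟨?_, ?_, ?_, ?_, ?_, ?_⟩
  · exact strict_of_comp hs (a := 𝟙 _) (b := 𝟙 _) inferInstance inferInstance hq hi (by simp [hβ])
  · exact strict_of_comp hs (a := 𝟙 _) (b := 𝟙 _) inferInstance inferInstance hp hj (by simp [hγ])
  · rw [isKernelOf_iff]
    refine ⟨hβγ, inferInstance, fun W t ht => ?_⟩
    obtain ⟨l, hl⟩ := k2 t (by rw [← cancel_mono j, Category.assoc, hγ, ht, zero_comp])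
    exact ⟨l ≫ a, by rw [Category.assoc, ha, hl]⟩
  · refine h.ssk.pushout (s := a) (t := 𝟙 _) ?_
    have : IsIso a := ⟨b, hab, hba⟩
    exact IsPushout.of_vert_isIso ⟨by rw [ha, Category.comp_id]⟩
  · rw [isCokernelOf_iff]
    have hz : kernel.ι γ ≫ p = 0 := by
      rw [← cancel_mono j, Category.assoc, hγ, kernel.condition, zero_comp]
    refine ⟨by rw [← hd, reassoc_of% hz, zero_comp], inferInstance, fun W t ht => ?_⟩
    have hiγ : i ≫ γ = 0 := by rw [← hγ, reassoc_of% k0, zero_comp]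
    obtain ⟨l, hl⟩ := c2 t (by rw [← kernel.lift_ι γ i hiγ, Category.assoc, ht, comp_zero])
    exact ⟨c ≫ l, by rw [reassoc_of% hc, hl]⟩
  · refine h.ssc.pullback (s := c) (t := 𝟙 _) ?_
    have : IsIso c := ⟨d, hcd, hdc⟩
    exact IsPullback.of_horiz_isIso ⟨by rw [hc, Category.id_comp]⟩

theorem iter_fac {D D₁ : C} (σ : D ⟶ D₁) (ρ : D₁ ⟶ D) (k : ℕ) :
    iterComp (σ ≫ ρ) (k + 1) = σ ≫ iterComp (ρ ≫ σ) k ≫ ρ := by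
  induction k with
  | zero => simp [iterComp]
  | succ k ih =>
    rw [iterComp, ih]
    simp [iterComp]

/-- If in an exact couple β and γ are strict, im β = ker γ is a semistable
kernel, cok β = coim γ is a semistable cokernel, and the powers α^k are strict for 1 ≤ k ≤ n
(n ≥ 1), then in the left and right derived couples the morphisms β₁⁻, γ₁⁻, β₁⁺, γ₁⁺ are
strict, im β₁⁻ = ker γ₁⁻ and im β₁⁺ = ker γ₁⁺ are semistable kernels, cok β₁⁻ = coim γ₁⁻ and
cok β₁⁺ = coim γ₁⁺ are semistable cokernels, and α₁^k is strict for 1 ≤ k ≤ n - 1; hence the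
derivation process can be iterated n times. -/
theorem derived_couples_iterable
    (hsemi : ∀ {X Y : C} (f : X ⟶ Y),
      Mono (Abelian.coimageImageComparison f) ∧ Epi (Abelian.coimageImageComparison f))
    -- the exact couple, with β and γ strict
    {D E D₁ Eρ E₁m : C} (α : D ⟶ D) (β : D ⟶ E) (γ : E ⟶ D)
    (hc1 : IsKernelOf (Abelian.image.ι α) β)
    (hc2 : IsKernelOf (Abelian.image.ι β) γ)
    (hc3 : IsKernelOf (Abelian.image.ι γ) α)
    (hsβ : IsIso (Abelian.coimageImageComparison β))
    (hsγ : IsIso (Abelian.coimageImageComparison γ))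
    -- semistability of im β = ker γ and of cok β = coim γ
    (hssk : SemistableKernel (Abelian.image.ι β))
    (hssc : SemistableCokernel (cokernel.π β))
    -- the powers α^k are strict for 1 ≤ k ≤ n
    (n : ℕ) (hn : 1 ≤ n)
    (hpow : ∀ k : ℕ, 1 ≤ k → k ≤ n → IsIso (Abelian.coimageImageComparison (iterComp α k)))
    -- the strict factorization α = ρ ∘ σ with σ = cok γ and ρ = ker β
    (σ : D ⟶ D₁) (ρ : D₁ ⟶ D)
    (hσ : IsCokernelOf γ σ) (hρ : IsKernelOf ρ β) (hα : σ ≫ ρ = α)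
    -- left construction: pullback of γ along ρ
    (ρ' : Eρ ⟶ E) (γ' : Eρ ⟶ D₁) (hPB : IsPullback ρ' γ' γ ρ)
    (β' : D ⟶ Eρ) (hβ' : β' ≫ ρ' = β) (hβ'0 : β' ≫ γ' = 0)
    -- left construction: pushout of β' along σ
    (σ' : Eρ ⟶ E₁m) (β₁m : D₁ ⟶ E₁m) (hPO : IsPushout β' σ σ' β₁m)
    (γ₁m : E₁m ⟶ D₁) (hγ₁ : σ' ≫ γ₁m = γ') (hγ₁0 : β₁m ≫ γ₁m = 0)
    -- right construction: pushout of β along σ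
    {Eσ E₁p : C} (σ'' : E ⟶ Eσ) (β'' : D₁ ⟶ Eσ) (hPO' : IsPushout β σ σ'' β'')
    (γ'' : Eσ ⟶ D) (hγ'' : σ'' ≫ γ'' = γ) (hγ''0 : β'' ≫ γ'' = 0)
    -- right construction: pullback of γ'' along ρ
    (ρ'' : E₁p ⟶ Eσ) (γ₁p : E₁p ⟶ D₁) (hPB' : IsPullback ρ'' γ₁p γ'' ρ)
    (β₁p : D₁ ⟶ E₁p) (hβ₁p : β₁p ≫ ρ'' = β'') (hβ₁p0 : β₁p ≫ γ₁p = 0)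
    :
    -- the morphisms of the derived couples are strict
    (IsIso (Abelian.coimageImageComparison β₁m) ∧ IsIso (Abelian.coimageImageComparison γ₁m) ∧
     IsIso (Abelian.coimageImageComparison β₁p) ∧ IsIso (Abelian.coimageImageComparison γ₁p)) ∧
    -- im β₁⁻ = ker γ₁⁻ and im β₁⁺ = ker γ₁⁺ are semistable kernels
    (IsKernelOf (Abelian.image.ι β₁m) γ₁m ∧ SemistableKernel (Abelian.image.ι β₁m) ∧
     IsKernelOf (Abelian.image.ι β₁p) γ₁p ∧ SemistableKernel (Abelian.image.ι β₁p)) ∧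
    -- cok β₁⁻ = coim γ₁⁻ and cok β₁⁺ = coim γ₁⁺ are semistable cokernels
    (IsCokernelOf (kernel.ι γ₁m) (cokernel.π β₁m) ∧ SemistableCokernel (cokernel.π β₁m) ∧
     IsCokernelOf (kernel.ι γ₁p) (cokernel.π β₁p) ∧ SemistableCokernel (cokernel.π β₁p)) ∧
    -- the powers α₁^k of α₁ = σ∘ρ = ρ ≫ σ are strict for 1 ≤ k ≤ n - 1
    (∀ k : ℕ, 1 ≤ k → k ≤ n - 1 →
      IsIso (Abelian.coimageImageComparison (iterComp (ρ ≫ σ) k))) := by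
  have hs : SemiAb C := fun X Y f => hsemi f
  have : HasPushouts C := hasPushouts'
  have : HasPullbacks C := hasPullbacks'
  have sσ : StrongEpi σ := IsACokernel.strong ⟨_, _, hσ⟩
  have sρ : StrongMono ρ := IsAKernel.strong ⟨_, _, hρ⟩
  -- factor `β = q ≫ i`, `γ = p ≫ j`
  obtain ⟨K, i, q, sq, hqi, hssk, hc2⟩ : ∃ (K : C) (i : K ⟶ E) (q : D ⟶ K), StrongEpi q ∧
      q ≫ i = β ∧ SemistableKernel i ∧ IsKernelOf i γ := by
    have : StrongEpi (Abelian.coimage.π β) := strongEpi_cokernel _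
    exact ⟨_, Abelian.image.ι β, Abelian.coimage.π β ≫ Abelian.coimageImageComparison β,
      inferInstance, by rw [Category.assoc, Abelian.coimage_image_factorisation], hssk, hc2⟩
  obtain ⟨Q, p, j, sp, sj, hpj⟩ := strict_fac γ hsγ
  obtain ⟨k0, k1, k2⟩ := (isKernelOf_iff _ _).1 hc2
  have hses : SES i p := by
    have hβγ : β ≫ γ = 0 := by rw [← hqi, Category.assoc, k0, comp_zero]
    have hker : IsKernelOf i p := by
      rw [isKernelOf_iff]
      refine ⟨by rw [← cancel_mono j, Category.assoc, hpj, k0, zero_comp], k1, fun W t ht =>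
        k2 t (by rw [← hpj, reassoc_of% ht, zero_comp])⟩
    refine ⟨hker, sp.isCokernelOf_ker hs hker, hssk, ?_⟩
    have hβp : β ≫ p = 0 := by rw [← cancel_mono j, Category.assoc, hpj, hβγ, zero_comp]
    -- the canonical map `Cok β ⟶ Q` is an isomorphism
    have hdesc : cokernel.π β ≫ cokernel.desc β p hβp = p := cokernel.π_desc _ _ _
    obtain ⟨c0, c1, c2⟩ := (isCokernelOf_iff _ _).1 (sp.isCokernelOf_ker hs hker)
    obtain ⟨d, hd⟩ := c2 (cokernel.π β) (by
      rw [← cancel_epi q, reassoc_of% hqi, cokernel.condition, comp_zero])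
    have : IsIso (cokernel.desc β p hβp) := ⟨d, by
      rw [← cancel_epi (cokernel.π β), reassoc_of% hdesc, hd, Category.comp_id], by
      rw [← cancel_epi p, reassoc_of% hd, hdesc, Category.comp_id]⟩
    refine hssc.pullback (t := 𝟙 _) (s := inv (cokernel.desc β p hβp)) ?_
    exact IsPullback.of_horiz_isIso ⟨by rw [Category.id_comp, IsIso.eq_comp_inv, hdesc]⟩
  -- the common pieces of both constructions
  have hQ := IsPullback.of_hasPullback j ρ
  have hK := IsPushout.of_hasPushout q σ
  have sj' := strongMono_pullback hQ sj
  have sq' := strongEpi_pushout hK sq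
  generalize pullback.snd j ρ = j' at hQ sj'
  generalize pullback.fst j ρ = k at hQ
  generalize pushout.inl q σ = s at hK
  generalize pushout.inr q σ = q₁ at hK sq'
  have hL : IsIso (Abelian.coimageImageComparison β₁m) ∧
      IsIso (Abelian.coimageImageComparison γ₁m) ∧
      IsKernelOf (Abelian.image.ι β₁m) γ₁m ∧ SemistableKernel (Abelian.image.ι β₁m) ∧
      IsCokernelOf (kernel.ι γ₁m) (cokernel.π β₁m) ∧ SemistableCokernel (cokernel.π β₁m) := by
    subst hpj
    have hP := IsPullback.of_bot' hPB hQ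
    have hp'j : hQ.lift (ρ' ≫ p) γ' (by rw [Category.assoc, hPB.w]) ≫ j' = γ' :=
      hQ.lift_snd _ _ _
    generalize hQ.lift (ρ' ≫ p) γ' (by rw [Category.assoc, hPB.w]) = p' at hP hp'j
    obtain ⟨i', hi', hses'⟩ := hses.pullback hs hP
    have hqi' : q ≫ i' = β' := hPB.hom_ext (by rw [Category.assoc, hi', hβ', hqi]) (by
      rw [hβ'0, ← hp'j, Category.assoc, reassoc_of% hses'.ker.1, zero_comp, comp_zero])
    subst hqi'
    have hU : IsPushout i' s σ' (hK.desc (i' ≫ σ') β₁m (by rw [← hPO.w, Category.assoc])) :=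
      IsPushout.of_left (h₁₁ := q) (v₁₁ := σ) (h₂₁ := q₁)
        (by rw [hK.inr_desc]; exact hPO) (by rw [hK.inl_desc]) hK
    have hq₁ : q₁ ≫ hK.desc (i' ≫ σ') β₁m (by rw [← hPO.w, Category.assoc]) = β₁m :=
      hK.inr_desc _ _ _
    generalize hK.desc (i' ≫ σ') β₁m (by rw [← hPO.w, Category.assoc]) = i₁ at hU hq₁
    obtain ⟨p₁, hp₁, hses₁⟩ := hses'.pushout hs hU
    refine final_step hs sq' sj' hses₁ hq₁ (hPO.hom_ext ?_ ?_)
    · rw [reassoc_of% hp₁, hp'j, hγ₁]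
    · rw [hγ₁0, ← hq₁, Category.assoc, reassoc_of% hses₁.ker.1, zero_comp, comp_zero]
  have hR : IsIso (Abelian.coimageImageComparison β₁p) ∧
      IsIso (Abelian.coimageImageComparison γ₁p) ∧
      IsKernelOf (Abelian.image.ι β₁p) γ₁p ∧ SemistableKernel (Abelian.image.ι β₁p) ∧
      IsCokernelOf (kernel.ι γ₁p) (cokernel.π β₁p) ∧ SemistableCokernel (cokernel.π β₁p) := by
    subst hqi
    have hU : IsPushout i s σ'' (hK.desc (i ≫ σ'') β'' (by rw [← hPO'.w, Category.assoc])) :=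
      IsPushout.of_left (h₁₁ := q) (v₁₁ := σ) (h₂₁ := q₁)
        (by rw [hK.inr_desc]; exact hPO') (by rw [hK.inl_desc]) hK
    have hq₁ : q₁ ≫ hK.desc (i ≫ σ'') β'' (by rw [← hPO'.w, Category.assoc]) = β'' :=
      hK.inr_desc _ _ _
    generalize hK.desc (i ≫ σ'') β'' (by rw [← hPO'.w, Category.assoc]) = i'' at hU hq₁
    obtain ⟨p'', hp'', hses''⟩ := hses.pushout hs hU
    have hpj'' : p'' ≫ j = γ'' := hPO'.hom_ext (by rw [reassoc_of% hp'', hpj, hγ'']) (by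
      rw [hγ''0, ← hq₁, Category.assoc, reassoc_of% hses''.ker.1, zero_comp, comp_zero])
    subst hpj''
    have hP := IsPullback.of_bot' hPB' hQ
    have hp₁ : hQ.lift (ρ'' ≫ p'') γ₁p (by rw [Category.assoc, hPB'.w]) ≫ j' = γ₁p :=
      hQ.lift_snd _ _ _
    generalize hQ.lift (ρ'' ≫ p'') γ₁p (by rw [Category.assoc, hPB'.w]) = p₁ at hP hp₁
    obtain ⟨i₁, hi₁, hses₁⟩ := hses''.pullback hs hP
    refine final_step hs sq' sj' hses₁ (hPB'.hom_ext ?_ ?_) hp₁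
    · rw [Category.assoc, hi₁, hq₁, hβ₁p]
    · rw [hβ₁p0, ← hp₁, Category.assoc, reassoc_of% hses₁.ker.1, zero_comp, comp_zero]
  obtain ⟨l1, l2, l3, l4, l5, l6⟩ := hL
  obtain ⟨r1, r2, r3, r4, r5, r6⟩ := hR
  refine ⟨⟨l1, l2, r1, r2⟩, ⟨l3, l4, r3, r4⟩, ⟨l5, l6, r5, r6⟩, fun k hk1 hk2 => ?_⟩
  obtain ⟨M, e, m, he, hm, hem⟩ := strict_fac _ (hpow (k + 1) (by omega) (by omega))
  refine strict_of_comp hs sσ sρ he hm ?_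
  rw [hem, ← hα, iter_fac]
end

section
/- Let A be a semiabelian category and let σ : X → A be a cokernel (a cokernel of some morphism), f : A → B a morphism, and ρ : B → Y a kernel (a kernel of some morphism). If the composite ρ∘f∘σ : X → Y is strict, then f is strict. -/
open CategoryTheory CategoryTheory.Limits

universe v u

variable {C : Type u} [Category.{v} C] [Preadditive C] [HasFiniteBiproducts C]
  [HasKernels C] [HasCokernels C]

/-- In a semiabelian category, if σ is a cokernel, ρ is a kernel and the
composite ρ∘f∘σ is strict, then f is strict. -/
theorem strict_of_cokernel_comp_kernel_strict
    (hsemi : ∀ {X Y : C} (f : X ⟶ Y),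
      Mono (Abelian.coimageImageComparison f) ∧ Epi (Abelian.coimageImageComparison f))
    {X A B Y : C} (σ : X ⟶ A) (f : A ⟶ B) (ρ : B ⟶ Y)
    (hσ : IsACokernel σ) (hρ : IsAKernel ρ)
    (h : IsIso (Abelian.coimageImageComparison (σ ≫ f ≫ ρ))) :
    IsIso (Abelian.coimageImageComparison f) := by
  obtain ⟨g, hg⟩ : ∃ g : X ⟶ Y, σ ≫ f ≫ ρ = g := ⟨_, rfl⟩
  rw [hg] at h
  have hE : Epi (Abelian.coimageImageComparison f) := (hsemi f).2
  have : Epi σ := by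
    obtain ⟨Z, k, w, ⟨hl⟩⟩ := hσ
    exact ⟨fun a b hab => Cofork.IsColimit.hom_ext hl hab⟩
  have : Mono ρ := by
    obtain ⟨Z, k, w, ⟨hl⟩⟩ := hρ
    exact ⟨fun a b hab => Fork.IsLimit.hom_ext hl hab⟩
  have := h
  -- the lift of the image of `f` to the image of the composite
  have h1 : (Abelian.image.ι f ≫ ρ) ≫ cokernel.π g = 0 := by
    have h2 : f ≫ ρ ≫ cokernel.π g = 0 := by
      rw [← cancel_epi σ, comp_zero]
      have h0 : (σ ≫ f ≫ ρ) ≫ cokernel.π g = 0 := by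
        rw [hg, cokernel.condition]
      simpa only [Category.assoc] using h0
    rw [Category.assoc, ← cokernel.π_desc f _ h2]
    have h3 : Abelian.image.ι f ≫ cokernel.π f = 0 := kernel.condition _
    rw [← Category.assoc, h3, zero_comp]
  obtain ⟨a, ha⟩ : ∃ a : Abelian.image f ⟶ Abelian.image g,
      a ≫ Abelian.image.ι g = Abelian.image.ι f ≫ ρ :=
    ⟨kernel.lift _ _ h1, kernel.lift_ι _ _ h1⟩
  -- the descent from the coimage of the composite to the coimage of `f`
  have h4 : kernel.ι g ≫ σ ≫ Abelian.coimage.π f = 0 := by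
    have h5 : (kernel.ι g ≫ σ) ≫ f = 0 := by
      rw [← cancel_mono ρ, zero_comp]
      have h0 : kernel.ι g ≫ (σ ≫ f ≫ ρ) = 0 := by
        rw [hg, kernel.condition]
      simpa only [Category.assoc] using h0
    rw [← Category.assoc, ← kernel.lift_ι f _ h5, Category.assoc]
    have h6 : kernel.ι f ≫ Abelian.coimage.π f = 0 := cokernel.condition _
    rw [h6, comp_zero]
  obtain ⟨b, hb⟩ : ∃ b : Abelian.coimage g ⟶ Abelian.coimage f,
      Abelian.coimage.π g ≫ b = σ ≫ Abelian.coimage.π f :=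
    ⟨cokernel.desc _ _ h4, cokernel.π_desc _ _ h4⟩
  have key : σ ≫ Abelian.coimage.π f ≫ Abelian.coimageImageComparison f ≫ a =
      Abelian.coimage.π g ≫ Abelian.coimageImageComparison g := by
    rw [← cancel_mono (Abelian.image.ι g)]
    simp only [Category.assoc, ha, Abelian.coimage_image_factorisation]
    have hf := congrArg (fun t => σ ≫ t ≫ ρ) (Abelian.coimage_image_factorisation f)
    simpa only [Category.assoc, hg] using hf
  have hs : Abelian.coimageImageComparison f ≫
      (a ≫ inv (Abelian.coimageImageComparison g) ≫ b) = 𝟙 _ := by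
    rw [← cancel_epi (Abelian.coimage.π f), ← cancel_epi σ]
    have := congrArg (fun t => t ≫ inv (Abelian.coimageImageComparison g) ≫ b) key
    simpa [hb] using this
  have : IsSplitMono (Abelian.coimageImageComparison f) := ⟨⟨⟨_, hs⟩⟩⟩
  exact isIso_of_epi_of_isSplitMono _
end

section
/- Let A be a semiabelian category, let f : X → A be a morphism and let ρ : A → B be a kernel (a kernel of some morphism). If the composite ρ∘f : X → B is strict, then f is strict. -/
open CategoryTheory CategoryTheory.Limits

universe v u

variable {C : Type u} [Category.{v} C] [Preadditive C] [HasFiniteBiproducts C]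
  [HasKernels C] [HasCokernels C]

/-- In a semiabelian category, if ρ is a kernel and the composite ρ∘f is
strict, then f is strict. -/
theorem strict_of_comp_kernel_strict
    (hsemi : ∀ {X Y : C} (f : X ⟶ Y),
      Mono (Abelian.coimageImageComparison f) ∧ Epi (Abelian.coimageImageComparison f))
    {X A B : C} (f : X ⟶ A) (ρ : A ⟶ B)
    (hρ : IsAKernel ρ)
    (h : IsIso (Abelian.coimageImageComparison (f ≫ ρ))) :
    IsIso (Abelian.coimageImageComparison f) := by
  obtain ⟨Z, g, w, ⟨hl⟩⟩ := hρ
  have hm : Mono ρ := ⟨fun a b hab => Fork.IsLimit.hom_ext hl hab⟩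
  have hmono := (hsemi f).1
  -- the image of `f` lies in the image of `f ≫ ρ`
  have hc : kernel.ι (cokernel.π f) ≫ ρ ≫ cokernel.π (f ≫ ρ) = 0 := by
    have e : ρ ≫ cokernel.π (f ≫ ρ) = cokernel.π f ≫
        cokernel.desc f (ρ ≫ cokernel.π (f ≫ ρ))
          (by rw [← Category.assoc, cokernel.condition]) := by
      rw [cokernel.π_desc]
    rw [e, ← Category.assoc, kernel.condition, zero_comp]
  let l : Abelian.image f ⟶ Abelian.image (f ≫ ρ) :=
    kernel.lift _ (kernel.ι (cokernel.π f) ≫ ρ) (by rw [Category.assoc, hc])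
  have hk : kernel.ι (f ≫ ρ) ≫ f = 0 := by
    rw [← cancel_mono ρ, Category.assoc, kernel.condition, zero_comp]
  let d : Abelian.coimage (f ≫ ρ) ⟶ Abelian.coimage f :=
    cokernel.desc _ (Abelian.coimage.π f) (by
      have e : kernel.ι (f ≫ ρ) = kernel.lift f _ hk ≫ kernel.ι f := by simp
      rw [e, Category.assoc, cokernel.condition, comp_zero])
  have hd : d ≫ Abelian.coimageImageComparison f ≫ Abelian.image.ι f ≫ ρ =
      Abelian.coimageImageComparison (f ≫ ρ) ≫ Abelian.image.ι (f ≫ ρ) := by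
    rw [← cancel_epi (Abelian.coimage.π (f ≫ ρ)), Abelian.coimage_image_factorisation,
      cokernel.π_desc_assoc, Abelian.coimage_image_factorisation_assoc]
  have hs : (inv (Abelian.coimageImageComparison (f ≫ ρ))) ≫ d ≫
      Abelian.coimageImageComparison f ≫ Abelian.image.ι f ≫ ρ =
        Abelian.image.ι (f ≫ ρ) := by
    rw [hd, IsIso.inv_hom_id_assoc]
  have hsplit : (l ≫ inv (Abelian.coimageImageComparison (f ≫ ρ)) ≫ d) ≫
      Abelian.coimageImageComparison f = 𝟙 _ := by
    rw [← cancel_mono (Abelian.image.ι f), ← cancel_mono ρ]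
    simp only [Category.assoc, Category.id_comp]
    rw [hs, kernel.lift_ι]
  refine ⟨⟨_, ?_, hsplit⟩⟩
  rw [← cancel_mono (Abelian.coimageImageComparison f), Category.assoc, hsplit,
    Category.comp_id, Category.id_comp]
end

section
/- Let A be a semiabelian category, let σ : X → A be a cokernel (a cokernel of some morphism) and let f : A → B be a morphism. If the composite f∘σ : X → B is strict, then f is strict. -/
open CategoryTheory CategoryTheory.Limits

universe v u

variable {C : Type u} [Category.{v} C] [Preadditive C] [HasFiniteBiproducts C]
  [HasKernels C] [HasCokernels C]

/-- In a semiabelian category, if σ is a cokernel and the composite f∘σ is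
strict, then f is strict. -/
theorem strict_of_cokernel_comp_strict
    (hsemi : ∀ {X Y : C} (f : X ⟶ Y),
      Mono (Abelian.coimageImageComparison f) ∧ Epi (Abelian.coimageImageComparison f))
    {X A B : C} (σ : X ⟶ A) (f : A ⟶ B)
    (hσ : IsACokernel σ)
    (h : IsIso (Abelian.coimageImageComparison (σ ≫ f))) :
    IsIso (Abelian.coimageImageComparison f) := by
  obtain ⟨W, g, w, ⟨hc⟩⟩ := hσ
  have hepi : Epi σ := Cofork.IsColimit.epi hc
  have hmono := (hsemi f).1
  have h1 : f ≫ cokernel.π (σ ≫ f) = 0 := by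
    rw [← cancel_epi σ, comp_zero, ← Category.assoc, cokernel.condition]
  have h2 : Abelian.image.ι f ≫ cokernel.π (σ ≫ f) = 0 := by
    rw [← cokernel.π_desc f (cokernel.π (σ ≫ f)) h1, ← Category.assoc]
    change (kernel.ι (cokernel.π f) ≫ cokernel.π f) ≫ _ = 0
    rw [kernel.condition, zero_comp]
  let l : Abelian.image f ⟶ Abelian.image (σ ≫ f) := kernel.lift _ (Abelian.image.ι f) h2
  have hl : l ≫ Abelian.image.ι (σ ≫ f) = Abelian.image.ι f := kernel.lift_ι _ _ _
  have h3 : kernel.ι (σ ≫ f) ≫ σ ≫ Abelian.coimage.π f = 0 := by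
    have e : (kernel.ι (σ ≫ f) ≫ σ) ≫ f = 0 := by
      rw [Category.assoc, kernel.condition]
    rw [← Category.assoc, ← kernel.lift_ι f _ e, Category.assoc]
    change _ ≫ kernel.ι f ≫ cokernel.π (kernel.ι f) = 0
    rw [cokernel.condition, comp_zero]
  let d : Abelian.coimage (σ ≫ f) ⟶ Abelian.coimage f :=
    cokernel.desc _ (σ ≫ Abelian.coimage.π f) h3
  have hd : Abelian.coimage.π (σ ≫ f) ≫ d = σ ≫ Abelian.coimage.π f := cokernel.π_desc _ _ _
  have h4 : d ≫ Abelian.coimageImageComparison f ≫ Abelian.image.ι f =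
      Abelian.coimageImageComparison (σ ≫ f) ≫ Abelian.image.ι (σ ≫ f) := by
    rw [← cancel_epi (Abelian.coimage.π (σ ≫ f)), ← Category.assoc, hd, Category.assoc,
      Abelian.coimage_image_factorisation, Abelian.coimage_image_factorisation]
  have h5 : (l ≫ inv (Abelian.coimageImageComparison (σ ≫ f)) ≫ d) ≫
      Abelian.coimageImageComparison f = 𝟙 _ := by
    rw [← cancel_mono (Abelian.image.ι f)]
    simp only [Category.assoc, h4, IsIso.inv_hom_id_assoc, hl, Category.id_comp]
  have : IsSplitEpi (Abelian.coimageImageComparison f) := ⟨⟨⟨_, h5⟩⟩⟩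
  exact isIso_of_mono_of_isSplitEpi _
end
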